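/- Let n, ℓ ≥ 1 be integers and let a_0, a_1, …, a_{n+ℓ} ∈ ℤ^n be pairwise distinct exponent vectors. Consider the system of n Laurent polynomial functions on the positive orthant, Φ_i(x) = Σ_{k=0}^{n+ℓ} c_{i,k} x^{a_k} for i = 1, …, n, with real coefficients c_{i,k}. Suppose that (i) a_0 lies in the relative interior of the convex hull of {a_1, …, a_{n+ℓ}} in ℝ^n, and (ii) there is no vector v ∈ ℝ^{n+ℓ} with all coordinates strictly positive such that Σ_{k=1}^{n+ℓ} c_{i,k} v_k = 0 for all i (i.e., the coefficient matrix of the monomials other than x^{a_0} has no positive vector in its kernel). Then the set of nondegenerate positive solutions—points x ∈ (0,∞)^n with Φ(x) = 0 at which the derivative of Φ : (0,∞)^n → ℝ^n is invertible—is finite and has at most (1 + 2^{−ℓ}(1 + ℓ/n))·2^{ℓ(ℓ−1)/2}·n^ℓ elements. -/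

import Mathlib

section

open MvPolynomial

/-- Every function on a finite set `Y` of points is the restriction of a polynomial of degree at
most `Y.card`. -/
theorem exists_totalDegree_le_card_eval_eq {ι K : Type*} [Field K]
    (Y : Finset (ι → K)) (h : (ι → K) → K) :
    ∃ p : MvPolynomial ι K, p.totalDegree ≤ Y.card ∧ ∀ y ∈ Y, eval y p = h y := by
  classical
  have sep : ∀ y y' : ι → K, ∃ p : MvPolynomial ι K, p.totalDegree ≤ 1 ∧
      (y' ≠ y → eval y p = 1 ∧ eval y' p = 0) := by
    intro y y'
    by_cases hy : y' = y
    · exact ⟨0, by simp, fun h => (h hy).elim⟩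
    obtain ⟨k, hk⟩ := Function.ne_iff.mp hy
    have hk' : y k - y' k ≠ 0 := sub_ne_zero.mpr (Ne.symm hk)
    refine ⟨C (y k - y' k)⁻¹ * (X k - C (y' k)), ?_, fun _ => ⟨?_, ?_⟩⟩
    · refine (totalDegree_mul _ _).trans ?_
      rw [totalDegree_C, zero_add]
      refine (totalDegree_sub _ _).trans ?_
      simp
    · simp [hk']
    · simp
  choose s hs1 hs2 using sep
  refine ⟨∑ y ∈ Y, C (h y) * ∏ y' ∈ Y.erase y, s y y', ?_, ?_⟩
  · refine totalDegree_finsetSum_le fun y hy => ?_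
    refine (totalDegree_mul _ _).trans ?_
    rw [totalDegree_C, zero_add]
    refine (totalDegree_finsetProd _ _).trans ?_
    refine (Finset.sum_le_card_nsmul _ _ 1 fun y' _ => hs1 y y').trans ?_
    simpa using Finset.card_le_card (Finset.erase_subset y Y)
  · intro y hy
    rw [map_sum, Finset.sum_eq_single_of_mem y hy]
    · rw [map_mul, eval_C, map_prod, Finset.prod_eq_one, mul_one]
      intro y' hy'
      exact (hs2 y y' (Finset.ne_of_mem_erase hy')).1
    · intro y' hy' hne
      rw [map_mul, map_prod, Finset.prod_eq_zero (Finset.mem_erase.mpr ⟨hne.symm, hy⟩), mul_zero]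
      exact (hs2 y' y hne.symm).2

/-- Every polynomial of degree at most `D` is a combination of the monomials `X ^ m` with
`m i < d i` for all `i`, plus an element of the ideal generated by the `X i ^ d i`. -/
theorem exists_reduced_add_sum_pow_mul {ι K : Type*} [Fintype ι] [Field K]
    (d : ι → ℕ) (D : ℕ) :
    ∃ W : Submodule K (MvPolynomial ι K), Module.Finite K W ∧
      Module.finrank K W ≤ ∏ i, d i ∧ W ≤ restrictTotalDegree ι K (D + ∑ i, d i) ∧
      ∀ p ∈ restrictTotalDegree ι K (D + ∑ i, d i), ∃ w ∈ W,
        ∃ Q : ι → MvPolynomial ι K, (∀ i, Q i ∈ restrictTotalDegree ι K (D + ∑ i, d i - d i)) ∧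
          p = w + ∑ i, X i ^ d i * Q i := by
  classical
  let b : ((i : ι) → Fin (d i)) → MvPolynomial ι K := fun m =>
    monomial (Finsupp.equivFunOnFinite.symm fun i => (m i : ℕ)) 1
  refine ⟨Submodule.span K (Set.range b), Module.Finite.span_of_finite K (Set.finite_range b), ?_, ?_, ?_⟩
  · refine (finrank_range_le_card b).trans ?_
    simp
  · rw [Submodule.span_le]
    rintro _ ⟨m, rfl⟩
    rw [SetLike.mem_coe, mem_restrictTotalDegree]
    refine (totalDegree_monomial_le _ _).trans ?_
    rw [Finsupp.sum_fintype _ _ (by simp)]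
    refine le_trans (Finset.sum_le_sum fun i _ => ?_) (Nat.le_add_left _ _)
    simp
  · intro p hp
    let T : Submodule K (MvPolynomial ι K) :=
      Submodule.span K (Set.range b) ⊔
        ⨆ i, (restrictTotalDegree ι K (D + ∑ i, d i - d i)).map (LinearMap.mulLeft K (X i ^ d i))
    have hpT : p ∈ T := by
      rw [p.as_sum]
      refine sum_mem fun m hm => ?_
      have hmD : (m.sum fun _ e => e) ≤ D + ∑ i, d i :=
        (le_totalDegree hm).trans ((mem_restrictTotalDegree _ _ _).mp hp)
      by_cases h : ∀ i, m i < d i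
      · refine Submodule.mem_sup_left ?_
        have : monomial m (coeff m p) = coeff m p • b (fun i => ⟨m i, h i⟩) := by
          simp only [b, smul_monomial, smul_eq_mul, mul_one]
          congr 1
          ext i
          simp
        rw [this]
        exact Submodule.smul_mem _ _ (Submodule.subset_span ⟨_, rfl⟩)
      · push Not at h
        obtain ⟨i, hi⟩ := h
        refine Submodule.mem_sup_right (Submodule.mem_iSup_of_mem i ?_)
        have hle : Finsupp.single i (d i) ≤ m := by simpa using hi
        refine ⟨monomial (m - Finsupp.single i (d i)) (coeff m p), ?_, ?_⟩
        · rw [SetLike.mem_coe, mem_restrictTotalDegree]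
          refine (totalDegree_monomial_le _ _).trans
            (show ((m - Finsupp.single i (d i)).sum fun _ e => e) ≤ _ from ?_)
          have hs : (m.sum fun _ e => e) =
              ((m - Finsupp.single i (d i)).sum fun _ e => e) + d i := by
            conv_lhs => rw [← tsub_add_cancel_of_le hle]
            rw [Finsupp.sum_add_index' (by simp) (by simp)]
            simp
          omega
        · rw [LinearMap.mulLeft_apply, X_pow_eq_monomial, monomial_mul, one_mul,
            add_tsub_cancel_of_le hle]
    obtain ⟨w, hw, r, hr, rfl⟩ := Submodule.mem_sup.mp hpT
    obtain ⟨f, hf, rfl⟩ := (Submodule.mem_iSup_iff_exists_finsupp _ _).mp hr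
    choose Q hQ1 hQ2 using hf
    refine ⟨w, hw, Q, hQ1, ?_⟩
    congr 1
    rw [Finsupp.sum_fintype _ _ (by simp)]
    exact Finset.sum_congr rfl fun i _ => (hQ2 i).symm

/-- For all but finitely many `t`, the system `P i + t * X i ^ d i` has no set of at most `M`
zeros with more than `∏ i, d i` elements. -/
theorem finite_setOf_prod_lt_card_zeros {ι K : Type*} [Fintype ι] [Field K]
    (P : ι → MvPolynomial ι K) (d : ι → ℕ) (hP : ∀ i, (P i).totalDegree ≤ d i) (M : ℕ) :
    {t : K | ∃ Y : Finset (ι → K), Y.card ≤ M ∧ ∏ i, d i < Y.card ∧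
      ∀ y ∈ Y, ∀ i, eval y (P i + C t * X i ^ d i) = 0}.Finite := by
  classical
  obtain ⟨W, hWfin, hWcard, hWV, hred⟩ := exists_reduced_add_sum_pow_mul (K := K) d M
  set D := M + ∑ i, d i with hD
  have hdD : ∀ i, d i ≤ D := fun i =>
    (Finset.single_le_sum (fun _ _ => Nat.zero_le _) (Finset.mem_univ i)).trans
      (Nat.le_add_left _ _)
  let V := restrictTotalDegree ι K D
  have hmem : ∀ i (f : MvPolynomial ι K), f.totalDegree ≤ d i →
      ∀ q ∈ restrictTotalDegree ι K (D - d i), f * q ∈ V := by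
    intro i f hf q hq
    rw [mem_restrictTotalDegree] at hq ⊢
    have := totalDegree_mul f q
    have := hdD i
    omega
  let Src := W × ((i : ι) → restrictTotalDegree ι K (D - d i))
  let ψ (f : ι → MvPolynomial ι K) : Src →ₗ[K] MvPolynomial ι K :=
    ∑ i, LinearMap.mulLeft K (f i) ∘ₗ Submodule.subtype _ ∘ₗ LinearMap.proj i ∘ₗ
      LinearMap.snd K W _
  have hψ : ∀ f s, ψ f s = ∑ i, f i * (s.2 i : MvPolynomial ι K) := by
    intro f s
    simp only [ψ, LinearMap.sum_apply]
    rfl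
  have hψV : ∀ f : ι → MvPolynomial ι K, (∀ i, (f i).totalDegree ≤ d i) → ∀ s, ψ f s ∈ V := by
    intro f hf s
    rw [hψ]
    exact sum_mem fun i _ => hmem i _ (hf i) _ (s.2 i).2
  have hX : ∀ i, (X i ^ d i : MvPolynomial ι K).totalDegree ≤ d i := by
    intro i
    rw [totalDegree_X_pow]
  let T₀ : Src →ₗ[K] V := LinearMap.codRestrict V
    (W.subtype ∘ₗ LinearMap.fst K W _ + ψ fun i => X i ^ d i)
    fun s => add_mem (hWV s.1.2) (hψV _ hX s)
  have hT₀v : ∀ s, (T₀ s : MvPolynomial ι K) = s.1 + ∑ i, X i ^ d i * (s.2 i : MvPolynomial ι K) := by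
    intro s
    rw [← hψ]
    rfl
  let T₁ : Src →ₗ[K] V := LinearMap.codRestrict V (ψ P) (hψV P hP)
  have hT₀ : LinearMap.range T₀ = ⊤ := by
    rw [LinearMap.range_eq_top]
    rintro ⟨p, hp⟩
    obtain ⟨w, hw, Q, hQ, rfl⟩ := hred p hp
    refine ⟨(⟨w, hw⟩, fun i => ⟨Q i, hQ i⟩), ?_⟩
    apply Subtype.ext
    rw [hT₀v]
  obtain ⟨R, hR⟩ := T₀.exists_rightInverse_of_surjective hT₀
  let B : Module.End K V := T₁ ∘ₗ R
  have hspec : (Neg.neg ⁻¹' spectrum K B).Finite :=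
    (Module.End.finite_spectrum B).preimage neg_injective.injOn
  refine hspec.subset ?_
  rintro t ⟨Y, hYM, hYd, hY⟩
  by_contra ht
  rw [Set.mem_preimage, spectrum.notMem_iff] at ht
  have hsurj : Function.Surjective (algebraMap K (Module.End K V) (-t) - B) :=
    ((Module.End.isUnit_iff _).mp ht).2
  let ev : W →ₗ[K] (Y → K) := LinearMap.pi fun y =>
    ((aeval (y : ι → K)).toLinearMap : MvPolynomial ι K →ₗ[K] K) ∘ₗ W.subtype
  have hev : ∀ w y, ev w y = eval (y : ι → K) (w : MvPolynomial ι K) := by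
    intro w y
    simp [ev, aeval_eq_eval]
  have hevs : Function.Surjective ev := by
    intro h
    obtain ⟨p, hp, hph⟩ := exists_totalDegree_le_card_eval_eq Y
      fun y => if hy : y ∈ Y then h ⟨y, hy⟩ else 0
    have hpV : p ∈ V := (mem_restrictTotalDegree _ _ _).mpr (by omega)
    obtain ⟨q, hq⟩ := hsurj ⟨p, hpV⟩
    refine ⟨-t • (R q).1, ?_⟩
    ext y
    have h1 := congrArg (fun v : V => eval (y : ι → K) (v : MvPolynomial ι K)) hq
    have h2 := congrArg (fun v : V => eval (y : ι → K) (v : MvPolynomial ι K))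
      (LinearMap.congr_fun hR q)
    have h3 : ∑ i, eval (y : ι → K) (P i) * eval (y : ι → K) ((R q).2 i : MvPolynomial ι K) +
        t * ∑ i, (y : ι → K) i ^ d i * eval (y : ι → K) ((R q).2 i : MvPolynomial ι K) = 0 := by
      rw [Finset.mul_sum, ← Finset.sum_add_distrib]
      refine Finset.sum_eq_zero fun i _ => ?_
      have := hY y y.2 i
      simp only [map_add, map_mul, eval_C, map_pow, eval_X] at this
      linear_combination this * eval (y : ι → K) ((R q).2 i : MvPolynomial ι K)
    simp only [LinearMap.comp_apply, hT₀v, LinearMap.id_apply, map_add, map_sum, map_mul, map_pow,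
      eval_X] at h2
    simp only [B, T₁, LinearMap.sub_apply, Module.algebraMap_end_apply, LinearMap.comp_apply,
      LinearMap.codRestrict_apply, Submodule.coe_sub, Submodule.coe_smul, hψ, map_sub, map_sum,
      map_mul, smul_eval] at h1
    rw [hph _ y.2, dif_pos y.2] at h1
    rw [hev]
    simp only [Submodule.coe_smul, smul_eval]
    linear_combination h1 - t * h2 + h3
  have := LinearMap.finrank_le_finrank_of_surjective hevs
  rw [Module.finrank_fintype_fun_eq_card, Fintype.card_coe] at this
  omega

open Set Filter Topology

theorem monotone_of_eventually_nhdsLT_nhdsGT {φ : ℝ → ℕ}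
    (hl : ∀ s, ∀ᶠ t in 𝓝[<] s, φ t ≤ φ s) (hr : ∀ s, ∀ᶠ t in 𝓝[>] s, φ s ≤ φ t) :
    Monotone φ := by
  intro a b hab
  let T := {t | t ∈ Icc a b ∧ φ a ≤ φ t}
  have haT : a ∈ T := ⟨left_mem_Icc.mpr hab, le_rfl⟩
  have hTb : BddAbove T := ⟨b, fun t ht => ht.1.2⟩
  set u := sSup T with hu
  have hau : a ≤ u := le_csSup hTb haT
  have hub : u ≤ b := csSup_le ⟨a, haT⟩ fun t ht => ht.1.2
  have huT : φ a ≤ φ u := by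
    obtain ⟨l, hlu, hl'⟩ := mem_nhdsLT_iff_exists_Ioo_subset.mp (hl u)
    obtain ⟨t, ht, hlt⟩ := exists_lt_of_lt_csSup ⟨a, haT⟩ (hu ▸ hlu)
    rcases (le_csSup hTb ht).eq_or_lt with h | h
    · rw [hu, ← h]
      exact ht.2
    · exact ht.2.trans (hl' ⟨hlt, h⟩)
  rcases hub.eq_or_lt with h | h
  · rwa [← h]
  · obtain ⟨r, hur, hr'⟩ := mem_nhdsGT_iff_exists_Ioo_subset.mp (hr u)
    obtain ⟨t, hut, ht⟩ := exists_between (lt_min hur h)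
    have htT : t ∈ T := ⟨⟨hau.trans hut.le, (ht.trans_le (min_le_right _ _)).le⟩,
      huT.trans (hr' ⟨hut, ht.trans_le (min_le_left _ _)⟩)⟩
    exact absurd (le_csSup hTb htT) (not_le.mpr hut)

theorem IsCompact.finite_of_forall_exists_nhds_subsingleton {X : Type*} [TopologicalSpace X]
    {K : Set X} (hK : IsCompact K) (h : ∀ z ∈ K, ∃ U ∈ 𝓝 z, (K ∩ U).Subsingleton) :
    K.Finite := by
  choose! U hU hsub using h
  obtain ⟨s, hs, hcov⟩ := hK.elim_nhds_subcover U hU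
  refine (s.finite_toSet.biUnion (t := fun z => K ∩ U z) fun z hz =>
    (hsub z (hs z hz)).finite).subset fun z hz => ?_
  obtain ⟨w, hw, hzw⟩ := mem_iUnion₂.mp (hcov hz)
  exact mem_iUnion₂.mpr ⟨w, hw, hz, hzw⟩

theorem card_fiber_le_card_filter_lt {X : Type*} [TopologicalSpace X] [T2Space X] {A : Set X}
    (hA : IsCompact A) {g : X → ℝ} (hg : Continuous g) (E : Finset X)
    (hinj : ∀ z ∈ A, ∃ U ∈ 𝓝 z, InjOn g (A ∩ U))
    (hopen : ∀ z ∈ A, z ∉ E → ∀ U ∈ 𝓝 z, g '' (A ∩ U) ∈ 𝓝 (g z))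
    (S : Finset X) (t : ℝ) (hS : ∀ z ∈ S, z ∈ A ∧ z ∉ E ∧ g z = t) :
    S.card ≤ (E.filter fun e => t < g e).card := by
  classical
  have hfin : ∀ s, {z | z ∈ A ∧ g z = s}.Finite := by
    intro s
    have hK : IsCompact {z | z ∈ A ∧ g z = s} :=
      hA.inter_right (isClosed_singleton.preimage hg : IsClosed (g ⁻¹' {s}))
    refine hK.finite_of_forall_exists_nhds_subsingleton fun z hz => ?_
    obtain ⟨U, hU, hUi⟩ := hinj z hz.1
    exact ⟨U, hU, fun x hx y hy => hUi ⟨hx.1.1, hx.2⟩ ⟨hy.1.1, hy.2⟩ (hx.1.2.trans hy.1.2.symm)⟩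
  let Z : ℝ → Set X := fun s => {z | z ∈ A ∧ z ∉ E ∧ g z = s}
  have hZfin : ∀ s, (Z s).Finite := fun s => (hfin s).subset fun z hz => ⟨hz.1, hz.2.2⟩
  let φ : ℝ → ℕ := fun s => (Z s).ncard + (E.filter fun e => g e ≤ s).card
  have hleft : ∀ s, ∀ᶠ r in 𝓝[<] s, φ r ≤ φ s := by
    intro s
    choose! U hU hUi using hinj
    have hU' : ∀ z, z ∈ A → z ∈ interior (U z) := fun z hz => mem_interior_iff_mem_nhds.mpr (hU z hz)
    let O := ⋃ z ∈ {z | z ∈ A ∧ g z = s}, interior (U z)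
    have hO : IsOpen O := isOpen_biUnion fun z _ => isOpen_interior
    have hC : IsClosed (g '' (A \ O)) := ((hA.diff hO).image hg).isClosed
    have hs : s ∉ g '' (A \ O) := by
      rintro ⟨z, ⟨hzA, hzO⟩, hzs⟩
      exact hzO (mem_iUnion₂.mpr ⟨z, ⟨hzA, hzs⟩, hU' z hzA⟩)
    filter_upwards [nhdsWithin_le_nhds (hC.isOpen_compl.mem_nhds hs), self_mem_nhdsWithin]
      with r hr hrs
    rw [mem_Iio] at hrs
    have hmap : ∀ w ∈ Z r, ∃ z, (z ∈ A ∧ g z = s) ∧ w ∈ U z := by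
      intro w hw
      by_contra hcon
      refine hr ⟨w, ⟨hw.1, fun hwO => hcon ?_⟩, hw.2.2⟩
      obtain ⟨z, hz, hwz⟩ := mem_iUnion₂.mp hwO
      exact ⟨z, hz, interior_subset hwz⟩
    choose! f hf hfU using hmap
    have h1 : (Z r).ncard ≤ {z | z ∈ A ∧ g z = s}.ncard := by
      refine ncard_le_ncard_of_injOn f hf ?_ (hfin s)
      intro x hx y hy hxy
      refine hUi (f x) (hf x hx).1 ⟨hx.1, hfU x hx⟩ ⟨hy.1, ?_⟩ (hx.2.2.trans hy.2.2.symm)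
      rw [hxy]
      exact hfU y hy
    have h2 : {z | z ∈ A ∧ g z = s}.ncard ≤
        (Z s).ncard + (E.filter fun e => g e = s).card := by
      rw [← ncard_coe_finset]
      refine (ncard_le_ncard ?_ ((hZfin s).union (Finset.finite_toSet _))).trans (ncard_union_le _ _)
      rintro z ⟨hz, hzs⟩
      by_cases hzE : z ∈ E
      · exact Or.inr (by simp [hzE, hzs])
      · exact Or.inl ⟨hz, hzE, hzs⟩
    have h3 : (E.filter fun e => g e = s).card + (E.filter fun e => g e ≤ r).card ≤
        (E.filter fun e => g e ≤ s).card := by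
      rw [← Finset.card_union_of_disjoint]
      · refine Finset.card_le_card fun e he => ?_
        simp only [Finset.mem_union, Finset.mem_filter] at he ⊢
        rcases he with ⟨h, h'⟩ | ⟨h, h'⟩
        · exact ⟨h, h'.le⟩
        · exact ⟨h, h'.trans hrs.le⟩
      · rw [Finset.disjoint_filter]
        intro e _ h h'
        linarith
    simp only [φ]
    omega
  have hright : ∀ s, ∀ᶠ r in 𝓝[>] s, φ s ≤ φ r := by
    intro s
    obtain ⟨V, hV, hdisj⟩ := (hZfin s).t2_separation
    have hev : ∀ᶠ r in 𝓝 s, ∀ z ∈ Z s, ∃ w ∈ A ∩ (V z ∩ (E : Set X)ᶜ), g w = r := by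
      refine (eventually_all_finite (hZfin s)).mpr fun z hz => ?_
      have := hopen z hz.1 hz.2.1 (V z ∩ (E : Set X)ᶜ) (inter_mem ((hV z).2.mem_nhds (hV z).1)
        (E.finite_toSet.isClosed.isOpen_compl.mem_nhds hz.2.1))
      rwa [hz.2.2] at this
    filter_upwards [nhdsWithin_le_nhds hev, self_mem_nhdsWithin] with r hr hrs
    rw [mem_Ioi] at hrs
    choose! f hf hfg using hr
    have h1 : (Z s).ncard ≤ (Z r).ncard := by
      refine ncard_le_ncard_of_injOn f
        (fun z hz => ⟨(hf z hz).1, (hf z hz).2.2, hfg z hz⟩) ?_ (hZfin r)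
      intro x hx y hy hxy
      by_contra hne
      refine (Set.disjoint_left.mp (hdisj hx hy hne)) (hf x hx).2.1 ?_
      rw [hxy]
      exact (hf y hy).2.1
    have h2 : (E.filter fun e => g e ≤ s).card ≤ (E.filter fun e => g e ≤ r).card :=
      Finset.card_le_card (Finset.monotone_filter_right _ fun e _ he => le_trans he hrs.le)
    simp only [φ]
    omega
  have hmono := monotone_of_eventually_nhdsLT_nhdsGT hleft hright
  obtain ⟨T, hT⟩ := ((hA.union E.finite_toSet.isCompact).image hg).bddAbove
  have hZT : Z (max t T + 1) = ∅ := by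
    refine eq_empty_of_forall_notMem fun z hz => ?_
    have h1 := hT ⟨z, Or.inl hz.1, rfl⟩
    have h2 := hz.2.2
    have h3 := le_max_right t T
    linarith
  have hφ := hmono (show t ≤ max t T + 1 by linarith [le_max_left t T])
  have hSZ : S.card ≤ (Z t).ncard := by
    rw [← ncard_coe_finset]
    exact ncard_le_ncard hS (hZfin t)
  have hE : (E.filter fun e => g e ≤ t).card + (E.filter fun e => t < g e).card = E.card := by
    simp only [← not_le]
    exact Finset.card_filter_add_card_filter_not _
  have hE' : (E.filter fun e => g e ≤ max t T + 1).card ≤ E.card := Finset.card_filter_le _ _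
  simp only [φ, hZT, ncard_empty] at hφ
  omega

/-- Let `g` be a locally injective function on a compact set `A` which is locally open away from a
finite set `E`. Then every fibre of `g` on `A \ E` has at most `E.card / 2` elements: moving away
from a point of the fibre in either direction along `A` ends in a point of `E`. -/
theorem two_mul_card_fiber_le {X : Type*} [TopologicalSpace X] [T2Space X] {A : Set X}
    (hA : IsCompact A) {g : X → ℝ} (hg : Continuous g) (E : Finset X)
    (hinj : ∀ z ∈ A, ∃ U ∈ 𝓝 z, InjOn g (A ∩ U))
    (hopen : ∀ z ∈ A, z ∉ E → ∀ U ∈ 𝓝 z, g '' (A ∩ U) ∈ 𝓝 (g z))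
    (S : Finset X) (t : ℝ) (hS : ∀ z ∈ S, z ∈ A ∧ z ∉ E ∧ g z = t) :
    2 * S.card ≤ E.card := by
  classical
  have h1 := card_fiber_le_card_filter_lt hA hg E hinj hopen S t hS
  have h2 := card_fiber_le_card_filter_lt hA (g := fun z => -g z) hg.neg E
    (fun z hz => by
      obtain ⟨U, hU, hUi⟩ := hinj z hz
      exact ⟨U, hU, fun x hx y hy hxy => hUi hx hy (neg_injective hxy)⟩)
    (fun z hz hzE U hU => by
      have := (continuous_neg.tendsto (-g z)).eventually
        (by rw [neg_neg]; exact hopen z hz hzE U hU : ∀ᶠ r in 𝓝 (-(-g z)), r ∈ g '' (A ∩ U))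
      filter_upwards [this] with r ⟨w, hw, hwr⟩
      exact ⟨w, hw, by simp [hwr]⟩)
    S (-t) (fun z hz => ⟨(hS z hz).1, (hS z hz).2.1, by rw [(hS z hz).2.2]⟩)
  have h3 : (E.filter fun e => t < g e).card + (E.filter fun e => -t < -g e).card ≤ E.card := by
    rw [← Finset.card_union_of_disjoint]
    · exact Finset.card_le_card
        (Finset.union_subset (Finset.filter_subset _ _) (Finset.filter_subset _ _))
    · rw [Finset.disjoint_filter]
      intro e _ h h'
      linarith
  omega

/-- Nondegenerate zeros of `F (0, ·)` persist as zeros of `F (p, ·)` for small `p`. -/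
theorem eventually_exists_zeros {P E : Type*} [NormedAddCommGroup P] [NormedSpace ℝ P]
    [CompleteSpace P] [NormedAddCommGroup E] [NormedSpace ℝ E] [CompleteSpace E]
    {F : P × E → E} (hF : ContDiff ℝ 1 F) (S : Finset E)
    (hS : ∀ z ∈ S, F (0, z) = 0 ∧ Function.Surjective (fderiv ℝ (fun w => F (0, w)) z))
    {W : Set (P × E)} (hW : ∀ z ∈ S, W ∈ 𝓝 (0, z)) :
    ∀ᶠ p in 𝓝 (0 : P), ∃ S' : Finset E, S'.card = S.card ∧ ∀ z ∈ S', F (p, z) = 0 ∧ (p, z) ∈ W := by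
  classical
  obtain ⟨V, hV, hdisj⟩ := S.finite_toSet.t2_separation
  have hev : ∀ᶠ p in 𝓝 (0 : P), ∀ z ∈ S, ∃ w ∈ V z, F (p, w) = 0 ∧ (p, w) ∈ W := by
    refine (eventually_all_finset S).mpr fun z hz => ?_
    obtain ⟨h0, hsurj⟩ := hS z hz
    have hd : HasStrictFDerivAt F (fderiv ℝ F (0, z)) (0, z) :=
      hF.contDiffAt.hasStrictFDerivAt one_ne_zero
    have hpart : ∀ v, fderiv ℝ (fun w => F (0, w)) z v = fderiv ℝ F (0, z) (0, v) := by
      intro v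
      have h1 : HasFDerivAt (fun w : E => ((0 : P), w)) (ContinuousLinearMap.inr ℝ P E) z :=
        hasFDerivAt_prodMk_right 0 z
      rw [show (fun w => F (0, w)) = F ∘ fun w => ((0 : P), w) from rfl,
        (hd.hasFDerivAt.comp z h1).fderiv]
      rfl
    have hG : HasStrictFDerivAt (fun x : P × E => (x.1, F x))
        ((ContinuousLinearMap.fst ℝ P E).prod (fderiv ℝ F (0, z))) (0, z) :=
      hasStrictFDerivAt_fst.prodMk hd
    have hrange : ((ContinuousLinearMap.fst ℝ P E).prod (fderiv ℝ F (0, z))).range = ⊤ := by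
      rw [LinearMap.range_eq_top]
      rintro ⟨a, b⟩
      obtain ⟨v, hv⟩ := hsurj (b - fderiv ℝ F (0, z) (a, 0))
      rw [hpart] at hv
      refine ⟨(a, v), ?_⟩
      have hav : ((a, v) : P × E) = (a, 0) + (0, v) := by simp
      refine Prod.ext rfl ?_
      change fderiv ℝ F (0, z) (a, v) = b
      rw [hav, map_add, hv]
      abel
    have hmap := hG.map_nhds_eq_of_surj hrange
    have hnhds : W ∩ (univ ×ˢ V z) ∈ 𝓝 ((0 : P), z) :=
      inter_mem (hW z hz) (prod_mem_nhds univ_mem ((hV z).2.mem_nhds (hV z).1))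
    have him := image_mem_map (m := fun x : P × E => (x.1, F x)) hnhds
    rw [hmap, h0] at him
    have hcont : Tendsto (fun p : P => (p, (0 : E))) (𝓝 0) (𝓝 (0, 0)) :=
      (Continuous.prodMk_left (0 : E)).tendsto 0
    filter_upwards [hcont him] with p hp
    obtain ⟨⟨p', w⟩, ⟨hw1, hw2⟩, hpw⟩ := hp
    obtain ⟨hp', hpw⟩ := Prod.mk.inj hpw
    dsimp only at hp' hpw
    rw [← hp']
    exact ⟨w, hw2.2, hpw, hw1⟩
  filter_upwards [hev] with p hp
  choose! w hwV hw using hp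
  refine ⟨S.image w, Finset.card_image_of_injOn fun x hx y hy hxy => ?_, ?_⟩
  · by_contra hne
    refine Set.disjoint_left.mp (hdisj hx hy hne) (hwV x hx) ?_
    rw [hxy]
    exact hwV y hy
  · intro z hz
    obtain ⟨x, hx, rfl⟩ := Finset.mem_image.mp hz
    exact hw x hx

section LocalDiffeomorphism

variable {E : Type*} [NormedAddCommGroup E] [NormedSpace ℝ E] [FiniteDimensional ℝ E]

theorem ContDiff.hasStrictFDerivAt_equiv_of_det_ne_zero {f : E → E} (hf : ContDiff ℝ 1 f) {z : E}
    (hz : (fderiv ℝ f z).det ≠ 0) :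
    HasStrictFDerivAt f ((fderiv ℝ f z).toContinuousLinearEquivOfDetNeZero hz : E →L[ℝ] E) z := by
  rw [ContinuousLinearMap.coe_toContinuousLinearEquivOfDetNeZero]
  exact hf.contDiffAt.hasStrictFDerivAt one_ne_zero

theorem ContDiff.map_nhds_eq_of_det_ne_zero {f : E → E} (hf : ContDiff ℝ 1 f) {z : E}
    (hz : (fderiv ℝ f z).det ≠ 0) : map f (𝓝 z) = 𝓝 (f z) := by
  have := FiniteDimensional.complete ℝ E
  exact (hf.hasStrictFDerivAt_equiv_of_det_ne_zero hz).map_nhds_eq_of_equiv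

theorem ContDiff.exists_nhds_injOn_of_det_ne_zero {f : E → E} (hf : ContDiff ℝ 1 f) {z : E}
    (hz : (fderiv ℝ f z).det ≠ 0) : ∃ U ∈ 𝓝 z, InjOn f U := by
  have := FiniteDimensional.complete ℝ E
  have h := (hf.hasStrictFDerivAt_equiv_of_det_ne_zero hz).eventually_left_inverse
  refine ⟨_, h, fun x hx y hy hxy => ?_⟩
  rw [← mem_ofPred_eq.mp hx, hxy, mem_ofPred_eq.mp hy]

theorem ContDiff.surjective_fderiv_of_det_ne_zero {f : E → E} {z : E}
    (hz : (fderiv ℝ f z).det ≠ 0) : Function.Surjective (fderiv ℝ f z) := by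
  intro w
  obtain ⟨v, hv⟩ := ((fderiv ℝ f z).toContinuousLinearEquivOfDetNeZero hz).surjective w
  exact ⟨v, hv⟩

theorem IsCompact.finite_inter_fiber_of_det_ne_zero {K : Set E} (hK : IsCompact K) {f : E → E}
    (hf : ContDiff ℝ 1 f) (v : E) (h : ∀ z ∈ K, f z = v → (fderiv ℝ f z).det ≠ 0) :
    {z | z ∈ K ∧ f z = v}.Finite := by
  have hK' : IsCompact {z | z ∈ K ∧ f z = v} :=
    hK.inter_right (isClosed_singleton.preimage hf.continuous : IsClosed (f ⁻¹' {v}))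
  refine hK'.finite_of_forall_exists_nhds_subsingleton fun z hz => ?_
  obtain ⟨U, hU, hUi⟩ := hf.exists_nhds_injOn_of_det_ne_zero (h z hz.1 hz.2)
  exact ⟨U, hU, fun x hx y hy => hUi hx.2 hy.2 (hx.1.2.trans hy.1.2.symm)⟩

end LocalDiffeomorphism

theorem ContDiff.ae_forall_det_fderiv_ne_zero {ι : Type*} [Fintype ι]
    {f : (ι → ℝ) → ι → ℝ} (hf : ContDiff ℝ 1 f) :
    ∀ᵐ v : ι → ℝ, ∀ z, f z = v → (fderiv ℝ f z).det ≠ 0 := by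
  have h : MeasureTheory.volume (f '' {z | (fderiv ℝ f z).det = 0}) = 0 :=
    MeasureTheory.addHaar_image_eq_zero_of_det_fderivWithin_eq_zero _
      (fun z _ => ((hf.differentiable one_ne_zero) z).hasFDerivAt.hasFDerivWithinAt)
      fun z hz => hz
  filter_upwards [MeasureTheory.compl_mem_ae_iff.mpr h] with v hv z hz hdet
  exact hv ⟨z, hdet, hz⟩

theorem ContDiff.functionUpdate {ι : Type*} [Fintype ι] [DecidableEq ι] {f : (ι → ℝ) → ι → ℝ}
    (hf : ContDiff ℝ 1 f) (q : ι) {g : (ι → ℝ) → ℝ} (hg : ContDiff ℝ 1 g) :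
    ContDiff ℝ 1 fun z => Function.update (f z) q (g z) := by
  rw [contDiff_pi]
  intro i
  by_cases h : i = q
  · subst h
    simpa using hg
  · simpa [h] using contDiff_pi.mp hf i

/-- A form of the Khovanskii--Rolle theorem. Let `J` be the Jacobian determinant of `f`, and let
`B` be a function whose superlevel sets are bounded near the curve `f z i = 0` for `i ≠ q`.
Then twice the number of nondegenerate zeros of `f` is at most the total number of nondegenerate
solutions of the three systems obtained by keeping generic nearby values of the `f z i` for
`i ≠ q` and prescribing a small value of `J`, its opposite, and a very negative value of `B`. -/
theorem exists_two_mul_card_zeros_le {ι : Type*} [Fintype ι] [DecidableEq ι] (q : ι)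
    {f : (ι → ℝ) → ι → ℝ} (hf : ContDiff ℝ 1 f) {J B : (ι → ℝ) → ℝ} (hJ : ContDiff ℝ 1 J)
    (hB : ContDiff ℝ 1 B) (hJf : ∀ z, J z = (fderiv ℝ f z).det) {δ : ℝ} (hδ : 0 < δ)
    (hbdd : ∀ R, Bornology.IsBounded {z | (∀ i, i ≠ q → |f z i| ≤ δ) ∧ R ≤ B z})
    (S : Finset (ι → ℝ)) (hS : ∀ z ∈ S, f z = 0 ∧ J z ≠ 0) (R₀ : ℝ) :
    ∃ v : ι → ℝ, (∀ i, |v i| < δ) ∧ ∃ R ≤ R₀, ∃ T₁ T₂ T₃ : Finset (ι → ℝ),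
      2 * S.card ≤ T₁.card + T₂.card + T₃.card ∧
      (∀ z ∈ T₁, Function.update (f z) q (J z) = v ∧
        (fderiv ℝ (fun z => Function.update (f z) q (J z)) z).det ≠ 0) ∧
      (∀ z ∈ T₂, Function.update (f z) q (-J z) = v ∧
        (fderiv ℝ (fun z => Function.update (f z) q (-J z)) z).det ≠ 0) ∧
      (∀ z ∈ T₃, Function.update (f z) q (B z - R) = v ∧
        (fderiv ℝ (fun z => Function.update (f z) q (B z - R)) z).det ≠ 0) := by
  obtain ⟨m, hm, hmS⟩ : ∃ m : ℝ, 0 < m ∧ ∀ z ∈ S, m < |J z| := by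
    have : ∀ᶠ m in 𝓝[>] (0 : ℝ), ∀ z ∈ S, m < |J z| :=
      (eventually_all_finset S).mpr fun z hz =>
        nhdsWithin_le_nhds (eventually_lt_nhds (abs_pos.mpr (hS z hz).2))
    obtain ⟨m, h1, h2⟩ := (this.and self_mem_nhdsWithin).exists
    exact ⟨m, h2, h1⟩
  obtain ⟨R, hR, hRS⟩ : ∃ R ≤ R₀, ∀ z ∈ S, R + 1 < B z := by
    have : ∀ᶠ R in atBot, ∀ z ∈ S, R < B z - 1 :=
      (eventually_all_finset S).mpr fun z _ => eventually_lt_atBot _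
    obtain ⟨R, h1, h2⟩ := (this.and (eventually_le_atBot R₀)).exists
    exact ⟨R, h2, fun z hz => by linarith [h1 z hz]⟩
  have hupd : ContDiff ℝ 1 fun v : ι → ℝ => Function.update v q 0 := by
    rw [contDiff_pi]
    intro i
    by_cases h : i = q
    · subst h
      simpa using contDiff_const
    · simpa [h] using contDiff_apply ℝ ℝ i
  have hpersist := eventually_exists_zeros
    (F := fun x : (ι → ℝ) × (ι → ℝ) => f x.2 - Function.update x.1 q 0)
    ((hf.comp contDiff_snd).sub (hupd.comp contDiff_fst)) S
    (W := {x | m < |J x.2| ∧ R + 1 < B x.2})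
    (by
      intro z hz
      have h0 : Function.update (0 : ι → ℝ) q 0 = 0 := by simp
      simp only [h0, sub_zero]
      exact ⟨(hS z hz).1, ContDiff.surjective_fderiv_of_det_ne_zero (hJf z ▸ (hS z hz).2)⟩)
    (by
      intro z hz
      have hJc : Continuous fun x : (ι → ℝ) × (ι → ℝ) => |J x.2| :=
        (hJ.continuous.comp continuous_snd).abs
      have hBc : Continuous fun x : (ι → ℝ) × (ι → ℝ) => B x.2 := hB.continuous.comp continuous_snd
      exact ((isOpen_lt continuous_const hJc).inter (isOpen_lt continuous_const hBc)).mem_nhds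
        ⟨hmS z hz, hRS z hz⟩)
  obtain ⟨r, hr, hball⟩ := Metric.eventually_nhds_iff.mp hpersist
  let O : Set (ι → ℝ) := Metric.ball 0 (min r (min m (min 1 δ))) ∩ {v | 0 < v q}
  have hO : IsOpen O := Metric.isOpen_ball.inter (isOpen_lt continuous_const (continuous_apply q))
  have hρ : 0 < min r (min m (min 1 δ)) := by positivity
  have hOne : O.Nonempty := by
    refine ⟨fun _ => min r (min m (min 1 δ)) / 2, ?_, half_pos hρ⟩
    rw [mem_ball_zero_iff, pi_norm_lt_iff hρ]
    intro i
    rw [Real.norm_of_nonneg (half_pos hρ).le]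
    exact half_lt_self hρ
  have hFJ := hf.functionUpdate q hJ
  have hFJ' := hf.functionUpdate q hJ.neg
  have hFB := hf.functionUpdate q (hB.sub (contDiff_const (c := R)))
  obtain ⟨v, ⟨hvball, hvq⟩, hv₁, hv₂, hv₃⟩ : ∃ v ∈ O,
      (∀ z, Function.update (f z) q (J z) = v →
        (fderiv ℝ (fun z => Function.update (f z) q (J z)) z).det ≠ 0) ∧
      (∀ z, Function.update (f z) q (-J z) = v →
        (fderiv ℝ (fun z => Function.update (f z) q (-J z)) z).det ≠ 0) ∧
      (∀ z, Function.update (f z) q (B z - R) = v →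
        (fderiv ℝ (fun z => Function.update (f z) q (B z - R)) z).det ≠ 0) := by
    have hfreq : ∃ᵐ v : ι → ℝ, v ∈ O := by
      rw [MeasureTheory.frequently_ae_mem_iff]
      exact (hO.measure_pos _ hOne).ne'
    obtain ⟨v, hvO, h1, h2, h3⟩ := (hfreq.and_eventually
      (hFJ.ae_forall_det_fderiv_ne_zero.and (hFJ'.ae_forall_det_fderiv_ne_zero.and
        hFB.ae_forall_det_fderiv_ne_zero))).exists
    exact ⟨v, hvO, h1, h2, h3⟩
  rw [mem_ofPred_eq] at hvq
  have hvi : ∀ i, |v i| < min r (min m (min 1 δ)) := by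
    rw [mem_ball_zero_iff, pi_norm_lt_iff hρ] at hvball
    exact hvball
  have hvδ : ∀ i, |v i| < δ := fun i => (hvi i).trans_le
    ((min_le_right _ _).trans ((min_le_right _ _).trans (min_le_right _ _)))
  have hvm : v q < m := (le_abs_self _).trans_lt ((hvi q).trans_le
    ((min_le_right _ _).trans (min_le_left _ _)))
  have hv1 : v q < 1 := (le_abs_self _).trans_lt ((hvi q).trans_le
    ((min_le_right _ _).trans ((min_le_right _ _).trans (min_le_left _ _))))
  obtain ⟨S', hS'card, hS'⟩ := hball (y := v) (by
    rw [mem_ball_zero_iff] at hvball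
    rw [dist_zero_right]
    exact hvball.trans_le (min_le_left _ _))
  let A : Set (ι → ℝ) := {z | (∀ i, i ≠ q → f z i = v i) ∧ v q ≤ |J z| ∧ v q + R ≤ B z}
  have hfi : ∀ i, Continuous fun z => f z i := fun i => (continuous_apply i).comp hf.continuous
  have hAc : IsCompact A := by
    refine Metric.isCompact_of_isClosed_isBounded ?_ ((hbdd (v q + R)).subset ?_)
    · refine IsClosed.inter (s₁ := {z | ∀ i, i ≠ q → f z i = v i}) ?_
        ((isClosed_le continuous_const hJ.continuous.abs).inter
          (isClosed_le continuous_const hB.continuous))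
      simp only [ofPred_forall]
      exact isClosed_iInter fun i => isClosed_iInter fun _ => isClosed_eq (hfi i) continuous_const
    · exact fun z hz => ⟨fun i hi => (hz.1 i hi ▸ (hvδ i).le), hz.2.2⟩
  have heq : ∀ (z : ι → ℝ) (c : ℝ), (∀ i, i ≠ q → f z i = v i) → c = v q →
      Function.update (f z) q c = v := by
    intro z c hz hc
    ext i
    by_cases h : i = q
    · subst h
      simpa using hc
    · simpa [h] using hz i h
  have hE₁ := hAc.finite_inter_fiber_of_det_ne_zero hFJ v fun z _ => hv₁ z
  have hE₂ := hAc.finite_inter_fiber_of_det_ne_zero hFJ' v fun z _ => hv₂ z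
  have hE₃ := hAc.finite_inter_fiber_of_det_ne_zero hFB v fun z _ => hv₃ z
  have hAJ : ∀ z ∈ A, (fderiv ℝ f z).det ≠ 0 := by
    intro z hz
    rw [← hJf, ← abs_pos]
    exact hvq.trans_le hz.2.1
  classical
  refine ⟨v, hvδ, R, hR, hE₁.toFinset, hE₂.toFinset, hE₃.toFinset, ?_,
    fun z hz => ?_, fun z hz => ?_, fun z hz => ?_⟩
  · rw [← hS'card]
    refine (two_mul_card_fiber_le hAc (hfi q) (hE₁.toFinset ∪ hE₂.toFinset ∪ hE₃.toFinset)
      ?_ ?_ S' 0 ?_).trans ?_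
    · intro z hz
      obtain ⟨U, hU, hUi⟩ := hf.exists_nhds_injOn_of_det_ne_zero (hAJ z hz)
      refine ⟨U, hU, fun x hx y hy hxy => hUi hx.2 hy.2 ?_⟩
      ext i
      by_cases h : i = q
      · rw [h]
        exact hxy
      · rw [hx.1.1 i h, hy.1.1 i h]
    · intro z hz hzE U hU
      simp only [Finset.mem_union, Finite.mem_toFinset, mem_ofPred_eq, not_or, not_and] at hzE
      obtain ⟨⟨hz1, hz2⟩, hz3⟩ := hzE
      have hJlt : v q < |J z| := by
        refine lt_of_le_of_ne hz.2.1 fun h => ?_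
        rcases abs_choice (J z) with h' | h'
        · exact hz1 hz (heq z _ hz.1 (by rw [h, h']))
        · exact hz2 hz (heq z _ hz.1 (by rw [h, h']))
      have hBlt : v q + R < B z := by
        refine lt_of_le_of_ne hz.2.2 fun h => ?_
        exact hz3 hz (heq z _ hz.1 (by rw [← h]; ring))
      have hU' : U ∩ {w | v q < |J w| ∧ v q + R < B w} ∈ 𝓝 z :=
        inter_mem hU (((isOpen_lt continuous_const hJ.continuous.abs).inter
          (isOpen_lt continuous_const hB.continuous)).mem_nhds ⟨hJlt, hBlt⟩)
      have him := image_mem_map (m := f) hU'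
      rw [hf.map_nhds_eq_of_det_ne_zero (hAJ z hz)] at him
      have hcont : Tendsto (fun t : ℝ => Function.update (f z) q t) (𝓝 (f z q)) (𝓝 (f z)) := by
        have : Continuous fun t : ℝ => Function.update (f z) q t :=
          continuous_const.update q continuous_id
        simpa using this.tendsto (f z q)
      filter_upwards [hcont him] with t ⟨w, hw, hwt⟩
      refine ⟨w, ⟨⟨fun i hi => ?_, hw.2.1.le, hw.2.2.le⟩, hw.1⟩, ?_⟩
      · simp [hwt, hi, hz.1 i hi]
      · simp [hwt]
    · intro z hz
      obtain ⟨hz1, hz2, hz3⟩ := hS' z hz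
      have hzf : ∀ i, f z i = Function.update v q 0 i := fun i =>
        sub_eq_zero.mp (congrFun hz1 i)
      have hzA : ∀ i, i ≠ q → f z i = v i := fun i hi => by
        rw [hzf, Function.update_of_ne hi]
      rw [mem_ofPred_eq] at *
      refine ⟨⟨hzA, (hvm.trans hz2).le, by linarith⟩, ?_, by rw [hzf, Function.update_self]⟩
      simp only [Finset.mem_union, Finite.mem_toFinset, mem_ofPred_eq, not_or, not_and]
      refine ⟨⟨fun _ h => ?_, fun _ h => ?_⟩, fun _ h => ?_⟩
      · have := congrFun h q
        rw [Function.update_self] at this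
        rw [this, abs_of_pos hvq] at hz2
        linarith
      · have := congrFun h q
        rw [Function.update_self] at this
        rw [← abs_neg, this, abs_of_pos hvq] at hz2
        linarith
      · have := congrFun h q
        rw [Function.update_self] at this
        linarith
    · exact (Finset.card_union_le _ _).trans (Nat.add_le_add_right (Finset.card_union_le _ _) _)
  · obtain ⟨-, h⟩ := (Finite.mem_toFinset _).mp hz
    exact ⟨h, hv₁ z h⟩
  · obtain ⟨-, h⟩ := (Finite.mem_toFinset _).mp hz
    exact ⟨h, hv₂ z h⟩
  · obtain ⟨-, h⟩ := (Finite.mem_toFinset _).mp hz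
    exact ⟨h, hv₃ z h⟩

section LogSystem

variable {ι : Type*} [Fintype ι]

/-- The map `z ↦ P (exp z) + β z`, in logarithmic coordinates `z` on the positive orthant, for a
family of polynomials `P` and a matrix `β`. -/
noncomputable def logSystem (P : ι → MvPolynomial ι ℝ) (β : ι → ι → ℝ) (z : ι → ℝ) (i : ι) : ℝ :=
  eval (fun k => Real.exp (z k)) (P i) + ∑ k, β i k * z k

/-- The polynomial whose value at `exp z` is the Jacobian determinant of `logSystem P β`
at `z`. -/
noncomputable def logJacobian [DecidableEq ι] (P : ι → MvPolynomial ι ℝ) (β : ι → ι → ℝ) :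
    MvPolynomial ι ℝ :=
  (Matrix.of fun i k => X k * pderiv k (P i) + C (β i k)).det

/-- A zero of `logSystem P β` at which the Jacobian determinant does not vanish. -/
def IsNondegenerateLogZero [DecidableEq ι] (P : ι → MvPolynomial ι ℝ) (β : ι → ι → ℝ)
    (z : ι → ℝ) : Prop :=
  logSystem P β z = 0 ∧ eval (fun k => Real.exp (z k)) (logJacobian P β) ≠ 0

theorem contDiff_eval_exp (P : MvPolynomial ι ℝ) :
    ContDiff ℝ 1 fun z : ι → ℝ => eval (fun k => Real.exp (z k)) P := by
  induction P using MvPolynomial.induction_on with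
  | C a => simpa using contDiff_const
  | add p q hp hq => simpa using hp.add hq
  | mul_X p k hp => simpa using hp.mul (Real.contDiff_exp.comp (contDiff_apply ℝ ℝ k))

theorem hasFDerivAt_eval_exp (P : MvPolynomial ι ℝ) (z : ι → ℝ) :
    HasFDerivAt (fun z : ι → ℝ => eval (fun k => Real.exp (z k)) P)
      (∑ k, eval (fun k => Real.exp (z k)) (X k * pderiv k P) •
        (ContinuousLinearMap.proj k : (ι → ℝ) →L[ℝ] ℝ)) z := by
  classical
  induction P using MvPolynomial.induction_on with
  | C a => simpa using hasFDerivAt_const a z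
  | add p q hp hq =>
    simp only [map_add]
    refine (hp.fun_add hq).congr_fderiv ?_
    ext v
    simp [mul_add, add_mul, Finset.sum_add_distrib]
  | mul_X p k hp =>
    have h1 : HasFDerivAt (fun z : ι → ℝ => Real.exp (z k))
        (Real.exp (z k) • (ContinuousLinearMap.proj k : (ι → ℝ) →L[ℝ] ℝ)) z :=
      (hasFDerivAt_apply k z).exp
    have h2 := hp.mul h1
    simp only [map_mul, eval_X]
    refine h2.congr_fderiv ?_
    ext v
    simp only [Derivation.leibniz, pderiv_X, map_mul, eval_X, smul_eq_mul, map_add,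
      add_apply, smul_apply, sum_apply,
      ContinuousLinearMap.proj_apply, mul_add, add_mul, Finset.sum_add_distrib, Finset.mul_sum]
    congr 1
    · rw [Finset.sum_eq_single k]
      · simp
        ring
      · intro j _ hj
        simp [Pi.single_eq_of_ne' hj]
      · simp
    · exact Finset.sum_congr rfl fun j _ => by ring

theorem totalDegree_X_mul_pderiv_le {σ : Type*} (P : MvPolynomial σ ℝ) (k : σ) :
    (X k * pderiv k P).totalDegree ≤ P.totalDegree := by
  have h : X k * pderiv k P = ∑ m ∈ P.support, m k • monomial m (coeff m P) := by
    conv_lhs => rw [P.as_sum]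
    rw [map_sum, Finset.mul_sum]
    exact Finset.sum_congr rfl fun m _ => X_mul_pderiv_monomial
  rw [h]
  refine totalDegree_finsetSum_le fun m hm => (totalDegree_smul_le _ _).trans ?_
  exact (totalDegree_monomial_le _ _).trans (le_totalDegree hm)

theorem totalDegree_logJacobian_le [DecidableEq ι] {P : ι → MvPolynomial ι ℝ} {β : ι → ι → ℝ}
    {d : ι → ℕ} (hd : ∀ i, (P i).totalDegree ≤ d i) :
    (logJacobian P β).totalDegree ≤ ∑ i, d i := by
  rw [logJacobian, Matrix.det_apply]
  refine totalDegree_finsetSum_le fun σ _ => (totalDegree_smul_le _ _).trans ?_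
  refine (totalDegree_finsetProd _ _).trans ?_
  rw [← Equiv.sum_comp σ d]
  refine Finset.sum_le_sum fun i _ => ?_
  rw [Matrix.of_apply]
  refine (totalDegree_add _ _).trans (max_le ?_ (by simp))
  exact (totalDegree_X_mul_pderiv_le _ _).trans (hd _)

theorem contDiff_logSystem (P : ι → MvPolynomial ι ℝ) (β : ι → ι → ℝ) :
    ContDiff ℝ 1 (logSystem P β) := by
  rw [contDiff_pi]
  intro i
  exact (contDiff_eval_exp (P i)).add
    (ContDiff.sum fun k _ => contDiff_const.mul (contDiff_apply ℝ ℝ k))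

theorem det_fderiv_logSystem [DecidableEq ι] (P : ι → MvPolynomial ι ℝ) (β : ι → ι → ℝ)
    (z : ι → ℝ) :
    (fderiv ℝ (logSystem P β) z).det = eval (fun k => Real.exp (z k)) (logJacobian P β) := by
  let M : Matrix ι ι ℝ :=
    Matrix.of fun i k => eval (fun k => Real.exp (z k)) (X k * pderiv k (P i) + C (β i k))
  have h : HasFDerivAt (logSystem P β) (Matrix.toLin' M).toContinuousLinearMap z := by
    rw [hasFDerivAt_pi']
    intro i
    have h1 : HasFDerivAt (fun z : ι → ℝ => ∑ k, β i k * z k)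
        (∑ k, β i k • (ContinuousLinearMap.proj k : (ι → ℝ) →L[ℝ] ℝ)) z :=
      HasFDerivAt.fun_sum fun k _ => (hasFDerivAt_apply k z).const_mul (β i k)
    refine ((hasFDerivAt_eval_exp (P i) z).add h1).congr_fderiv ?_
    ext v
    simp [M, Matrix.mulVec, dotProduct, add_mul, Finset.sum_add_distrib]
  rw [h.fderiv, logJacobian, RingHom.map_det]
  change LinearMap.det (Matrix.toLin' M) = _
  rw [LinearMap.det_toLin']
  rfl

theorem logJacobian_sub_C [DecidableEq ι] (P : ι → MvPolynomial ι ℝ) (β : ι → ι → ℝ)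
    (v : ι → ℝ) : logJacobian (fun i => P i - C (v i)) β = logJacobian P β := by
  simp [logJacobian]

theorem isNondegenerateLogZero_sub_C [DecidableEq ι] {P : ι → MvPolynomial ι ℝ} {β : ι → ι → ℝ}
    {v z : ι → ℝ} (h : logSystem P β z = v) (hdet : (fderiv ℝ (logSystem P β) z).det ≠ 0) :
    IsNondegenerateLogZero (fun i => P i - C (v i)) β z := by
  refine ⟨?_, ?_⟩
  · ext i
    have := congrFun h i
    simp only [logSystem, map_sub, eval_C, Pi.zero_apply] at this ⊢
    linarith
  · rwa [logJacobian_sub_C, ← det_fderiv_logSystem]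

theorem logSystem_update [DecidableEq ι] (P : ι → MvPolynomial ι ℝ) (β : ι → ι → ℝ)
    (q : ι) (p : MvPolynomial ι ℝ) (b : ι → ℝ) :
    logSystem (Function.update P q p) (Function.update β q b) =
      fun z => Function.update (logSystem P β z) q
        (eval (fun k => Real.exp (z k)) p + ∑ k, b k * z k) := by
  ext z i
  by_cases h : i = q
  · subst h
    simp [logSystem]
  · simp [logSystem, h]

/-- The hyperplane `∑ k, z k = -c` and the hypersurface `∏ k, exp (z k) = exp (-c)` coincide. -/
theorem IsNondegenerateLogZero.update_prod_X [DecidableEq ι] {P : ι → MvPolynomial ι ℝ}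
    {β : ι → ι → ℝ} {q : ι} {c : ℝ} {z : ι → ℝ}
    (h : IsNondegenerateLogZero (Function.update P q (C c)) (Function.update β q 1) z) :
    IsNondegenerateLogZero (Function.update P q (∏ k, X k - C (Real.exp (-c))))
      (Function.update β q 0) z := by
  obtain ⟨h0, hdet⟩ := h
  rw [logSystem_update] at h0
  have hsum : ∑ k, z k = -c := by
    have := congrFun h0 q
    simp only [Function.update_self, eval_C, Pi.one_apply, one_mul, Pi.zero_apply] at this
    linarith
  refine ⟨?_, ?_⟩
  · rw [logSystem_update]
    ext i
    by_cases hi : i = q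
    · subst hi
      simp [← Real.exp_sum, hsum]
    · have := congrFun h0 i
      simpa [hi] using this
  · have key : logJacobian (Function.update P q (∏ k, X k - C (Real.exp (-c))))
        (Function.update β q 0) =
        (∏ k, X k) * logJacobian (Function.update P q (C c)) (Function.update β q 1) := by
      have hX : ∀ k, X k * pderiv k (∏ j, X j : MvPolynomial ι ℝ) = ∏ j, X j := by
        intro k
        rw [← Finset.mul_prod_erase _ _ (Finset.mem_univ k), Derivation.leibniz, pderiv_X_self]
        have : pderiv k (∏ j ∈ Finset.univ.erase k, X j : MvPolynomial ι ℝ) = 0 := by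
          refine pderiv_eq_zero_of_notMem_vars fun hk => ?_
          obtain ⟨j, hj, hkj⟩ := Finset.mem_biUnion.mp (vars_prod _ hk)
          rw [vars_X, Finset.mem_singleton] at hkj
          exact Finset.ne_of_mem_erase hj hkj.symm
        rw [this]
        simp
      unfold logJacobian
      set N : Matrix ι ι (MvPolynomial ι ℝ) :=
        Matrix.of fun i k => X k * pderiv k (P i) + C (β i k) with hN
      have e1 : (Matrix.of fun i k =>
          X k * pderiv k (Function.update P q (∏ k, X k - C (Real.exp (-c))) i) +
            C (Function.update β q 0 i k)) =
          N.updateRow q ((∏ k, X k : MvPolynomial ι ℝ) • fun _ => 1) := by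
        ext1 i k
        by_cases hi : i = q
        · subst hi
          simp [hX]
        · simp [hi, hN, Matrix.updateRow_ne]
      have e2 : (Matrix.of fun i k =>
          X k * pderiv k (Function.update P q (C c) i) + C (Function.update β q 1 i k)) =
          N.updateRow q (fun _ => 1) := by
        ext1 i k
        by_cases hi : i = q
        · subst hi
          simp
        · simp [hi, hN, Matrix.updateRow_ne]
      rw [e1, e2, Matrix.det_updateRow_smul]
    rw [key, map_mul, map_prod]
    refine mul_ne_zero (Finset.prod_ne_zero_iff.mpr fun k _ => ?_) hdet
    rw [eval_X]
    exact (Real.exp_pos _).ne'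

/-- A form of Bézout's theorem: the number of nondegenerate positive zeros of a polynomial system
is at most the product of the degrees. -/
theorem card_le_prod_of_isNondegenerateLogZero [DecidableEq ι] {P : ι → MvPolynomial ι ℝ}
    {d : ι → ℕ} (hd : ∀ i, (P i).totalDegree ≤ d i) (S : Finset (ι → ℝ))
    (hS : ∀ z ∈ S, IsNondegenerateLogZero P 0 z) : S.card ≤ ∏ i, d i := by
  by_contra! hcard
  let F : ℝ × (ι → ℝ) → ι → ℝ := fun x i =>
    eval (fun k => Real.exp (x.2 k)) (P i) + x.1 * Real.exp (x.2 i) ^ d i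
  have hF : ContDiff ℝ 1 F := by
    rw [contDiff_pi]
    intro i
    exact ((contDiff_eval_exp (P i)).comp contDiff_snd).add (contDiff_fst.mul
      ((Real.contDiff_exp.comp ((contDiff_apply ℝ ℝ i).comp contDiff_snd)).pow _))
  have hF0 : (fun w => F (0, w)) = logSystem P 0 := by
    ext w i
    simp [F, logSystem]
  have hev := eventually_exists_zeros hF S (W := univ)
    (fun z hz => by
      refine ⟨(congrFun hF0 z).trans (hS z hz).1, ?_⟩
      rw [hF0]
      refine ContDiff.surjective_fderiv_of_det_ne_zero ?_
      rw [det_fderiv_logSystem]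
      exact (hS z hz).2)
    (fun _ _ => univ_mem)
  obtain ⟨t, ⟨S', hS'card, hS'⟩, ht⟩ :=
    (infinite_of_mem_nhds (0 : ℝ) hev).exists_notMem_finite
      (finite_setOf_prod_lt_card_zeros P d hd S.card)
  refine ht ⟨S'.image fun z k => Real.exp (z k), ?_, ?_, ?_⟩
  · rw [← hS'card]
    exact Finset.card_image_le
  · rw [Finset.card_image_of_injective, hS'card]
    · exact hcard
    · intro x y hxy
      ext k
      exact Real.exp_injective (congrFun hxy k)
  · intro y hy i
    obtain ⟨z, hz, rfl⟩ := Finset.mem_image.mp hy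
    simpa [F] using congrFun (hS' z hz).1 i

end LogSystem

theorem exists_forall_le_of_sum_mul_ge {ι : Type*} [Fintype ι] {b : ι → ℝ} (hb : ∀ k, 0 < b k)
    (C m : ℝ) : ∃ A, ∀ z : ι → ℝ, (∀ k, z k ≤ C) → m ≤ ∑ k, b k * z k → ∀ k, A ≤ z k := by
  classical
  obtain ⟨A, hA⟩ := (Set.finite_range fun k =>
    (m - ∑ j ∈ Finset.univ.erase k, b j * C) / b k).bddBelow
  refine ⟨A, fun z hz hm k => (hA ⟨k, rfl⟩).trans ?_⟩
  rw [div_le_iff₀ (hb k)]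
  rw [← Finset.add_sum_erase _ _ (Finset.mem_univ k)] at hm
  have : ∑ j ∈ Finset.univ.erase k, b j * z j ≤ ∑ j ∈ Finset.univ.erase k, b j * C :=
    Finset.sum_le_sum fun j _ => mul_le_mul_of_nonneg_left (hz j) (hb j).le
  linarith

theorem isBounded_of_forall_mem_Icc {ι : Type*} [Fintype ι] {s : Set (ι → ℝ)} {A C : ℝ}
    (h : ∀ z ∈ s, ∀ k, A ≤ z k ∧ z k ≤ C) : Bornology.IsBounded s :=
  (Metric.isBounded_Icc (fun _ => A) (fun _ => C)).subset
    fun z hz => ⟨fun k => (h z hz k).1, fun k => (h z hz k).2⟩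

section Khovanskii

variable {ι : Type*} [Fintype ι] [DecidableEq ι]

theorem logSystem_update_zero (P : ι → MvPolynomial ι ℝ) (β : ι → ι → ℝ) (q : ι)
    (p : MvPolynomial ι ℝ) :
    logSystem (Function.update P q p) (Function.update β q 0) =
      fun z => Function.update (logSystem P β z) q (eval (fun k => Real.exp (z k)) p) := by
  simp [logSystem_update]

theorem totalDegree_update_sub_C_le {σ : Type*} [DecidableEq σ] {P : σ → MvPolynomial σ ℝ}
    {d : σ → ℕ} (hd : ∀ i, (P i).totalDegree ≤ d i) {q : σ} {p : MvPolynomial σ ℝ} {e : ℕ}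
    (hp : p.totalDegree ≤ e) (v : σ → ℝ) (i : σ) :
    (Function.update P q p i - C (v i)).totalDegree ≤ Function.update d q e i := by
  refine (totalDegree_sub_C_le _ _).trans ?_
  by_cases h : i = q
  · subst h
    simpa using hp
  · simpa [h] using hd i

/-- Khovanskii's bound for a system in which the rows of `insert q₀ Q` are linear forms in the
logarithmic coordinates and the other rows are polynomials. The row `q₀` is a positive linear
form, and the rows of `L` bound the coordinates from above. -/
theorem two_mul_card_le_of_isNondegenerateLogZero {q₀ : ι} {L : Finset ι} (hL : q₀ ∉ L)
    (Q : Finset ι) (hqQ : q₀ ∉ Q) (hLQ : Disjoint L Q) {P : ι → MvPolynomial ι ℝ}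
    {β : ι → ι → ℝ} {d : ι → ℕ} (hd : ∀ i, (P i).totalDegree ≤ d i)
    (hdQ : ∀ i ∈ insert q₀ Q, d i = 0) (hβQ : ∀ i ∉ insert q₀ Q, β i = 0)
    (hβ : ∀ k, 0 < β q₀ k) {δ : ℝ} (hδ : 0 < δ) {c : ℝ}
    (hc : ∀ z, (∀ i ∈ L, |logSystem P β z i| ≤ δ) → ∀ k, z k ≤ c)
    (S : Finset (ι → ℝ)) (hS : ∀ z ∈ S, IsNondegenerateLogZero P β z) :
    2 * S.card ≤ (∏ i ∈ (insert q₀ Q)ᶜ, d i) *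
      (2 * ∏ k ∈ Finset.range (Q.card + 1), (2 ^ k * ∑ i, d i) +
        (∏ k ∈ Finset.range Q.card, (2 ^ k * ∑ i, d i)) * Fintype.card ι) := by
  have hJneg : ∀ (P : ι → MvPolynomial ι ℝ) (β : ι → ι → ℝ) (z : ι → ℝ),
      -eval (fun k => Real.exp (z k)) (logJacobian P β) =
        eval (fun k => Real.exp (z k)) (-logJacobian P β) := fun _ _ _ => (map_neg _ _).symm
  induction Q using Finset.induction_on generalizing P β d δ S with
  | empty =>
    have hB : ContDiff ℝ 1 fun z : ι → ℝ => ∑ k, z k :=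
      ContDiff.sum fun k _ => contDiff_apply ℝ ℝ k
    obtain ⟨v, -, R, -, T₁, T₂, T₃, hT, h1, h2, h3⟩ := exists_two_mul_card_zeros_le q₀
      (contDiff_logSystem P β) (contDiff_eval_exp (logJacobian P β)) hB
      (fun z => (det_fderiv_logSystem P β z).symm) hδ
      (fun R => by
        obtain ⟨A, hA⟩ := exists_forall_le_of_sum_mul_ge (b := fun _ : ι => 1)
          (fun _ => one_pos) c R
        refine isBounded_of_forall_mem_Icc (A := A) (C := c) fun z hz => ?_
        have hzc := hc z fun i hi => hz.1 i (ne_of_mem_of_not_mem hi hL)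
        exact fun k => ⟨hA z hzc (by simpa using hz.2) k, hzc k⟩)
      S (fun z hz => hS z hz) 0
    have hβ0 : Function.update β q₀ 0 = 0 := by
      ext i : 1
      by_cases h : i = q₀
      · subst h
        simp
      · simp [h, hβQ i (by simpa using h)]
    have hprod : ∀ e, ∏ i, Function.update d q₀ e i = e * ∏ i ∈ {q₀}ᶜ, d i := by
      intro e
      rw [Finset.prod_update_of_mem (Finset.mem_univ _), Finset.compl_eq_univ_sdiff]
    have hpoly : ∀ (p : MvPolynomial ι ℝ) (e : ℕ) (T : Finset (ι → ℝ)), p.totalDegree ≤ e →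
        (∀ z ∈ T, IsNondegenerateLogZero (fun i => Function.update P q₀ p i - C (v i)) 0 z) →
        T.card ≤ e * ∏ i ∈ {q₀}ᶜ, d i := by
      intro p e T hp h
      rw [← hprod]
      exact card_le_prod_of_isNondegenerateLogZero (totalDegree_update_sub_C_le hd hp v) T h
    have hT₁ : T₁.card ≤ (∑ i, d i) * ∏ i ∈ {q₀}ᶜ, d i := by
      refine hpoly (logJacobian P β) _ T₁ (totalDegree_logJacobian_le hd) fun z hz => ?_
      rw [← hβ0]
      have := h1 z hz
      refine isNondegenerateLogZero_sub_C ?_ ?_ <;> rw [logSystem_update_zero]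
      exacts [this.1, this.2]
    have hT₂ : T₂.card ≤ (∑ i, d i) * ∏ i ∈ {q₀}ᶜ, d i := by
      refine hpoly (-logJacobian P β) _ T₂
        ((totalDegree_neg _).trans_le (totalDegree_logJacobian_le hd)) fun z hz => ?_
      rw [← hβ0]
      have := h2 z hz
      simp only [hJneg] at this
      refine isNondegenerateLogZero_sub_C ?_ ?_ <;> rw [logSystem_update_zero]
      exacts [this.1, this.2]
    have hT₃ : T₃.card ≤ Fintype.card ι * ∏ i ∈ {q₀}ᶜ, d i := by
      rw [← hprod]
      refine card_le_prod_of_isNondegenerateLogZero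
        (P := Function.update (fun i => P i - C (v i)) q₀
          (∏ k, X k - C (Real.exp (-(-R - v q₀))))) (fun i => ?_) T₃ fun z hz => ?_
      · by_cases h : i = q₀
        · subst h
          simp only [Function.update_self]
          refine (totalDegree_sub_C_le _ _).trans ((totalDegree_finsetProd _ _).trans ?_)
          simp
        · simpa [h] using (totalDegree_sub_C_le (P i) (v i)).trans (hd i)
      · rw [← hβ0]
        refine IsNondegenerateLogZero.update_prod_X ?_
        have hsys : logSystem (Function.update P q₀ (C (-R))) (Function.update β q₀ 1) =
            fun z => Function.update (logSystem P β z) q₀ (∑ k, z k - R) := by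
          rw [logSystem_update]
          ext z i
          simp [neg_add_eq_sub]
        have := h3 z hz
        rw [← hsys] at this
        have h := isNondegenerateLogZero_sub_C (congrFun hsys z ▸ this.1) this.2
        convert h using 1
        ext1 i
        by_cases hi : i = q₀
        · subst hi
          simp
        · simp [hi]
    simp only [insert_empty_eq, Finset.card_empty, zero_add, Finset.range_one,
      Finset.prod_singleton, pow_zero, one_mul, Finset.range_zero, Finset.prod_empty]
    calc 2 * S.card ≤ T₁.card + T₂.card + T₃.card := hT
      _ ≤ (∑ i, d i) * ∏ i ∈ {q₀}ᶜ, d i + (∑ i, d i) * ∏ i ∈ {q₀}ᶜ, d i +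
          Fintype.card ι * ∏ i ∈ {q₀}ᶜ, d i := by gcongr
      _ = _ := by ring
  | insert q Q hq ih =>
    have hqq₀ : q₀ ≠ q := fun h => hqQ (h ▸ Finset.mem_insert_self _ _)
    have hqL : q ∉ L := Finset.disjoint_right.mp hLQ (Finset.mem_insert_self _ _)
    have hB : ContDiff ℝ 1 fun z : ι → ℝ => ∑ k, z k :=
      ContDiff.sum fun k _ => contDiff_apply ℝ ℝ k
    have hP₀ : ∃ a, P q₀ = C a := by
      refine ⟨_, totalDegree_eq_zero_iff_eq_C.mp (Nat.le_zero.mp ((hd q₀).trans_eq ?_))⟩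
      exact hdQ q₀ (Finset.mem_insert_self _ _)
    obtain ⟨a, ha⟩ := hP₀
    obtain ⟨A, hA⟩ := exists_forall_le_of_sum_mul_ge hβ c (-(δ / 2) - a)
    have hbox : ∀ z, (∀ i, i ≠ q → |logSystem P β z i| ≤ δ / 2) → ∀ k, A ≤ z k ∧ z k ≤ c := by
      intro z hz
      have hzc := hc z fun i hi => (hz i (ne_of_mem_of_not_mem hi hqL)).trans (half_le_self hδ.le)
      have hz₀ := (abs_le.mp (hz q₀ hqq₀)).1
      rw [logSystem, ha, eval_C] at hz₀
      exact fun k => ⟨hA z hzc (by linarith) k, hzc k⟩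
    obtain ⟨v, hv, R, hR, T₁, T₂, T₃, hT, h1, h2, h3⟩ := exists_two_mul_card_zeros_le q
      (contDiff_logSystem P β) (contDiff_eval_exp (logJacobian P β)) hB
      (fun z => (det_fderiv_logSystem P β z).symm) (half_pos hδ)
      (fun R => isBounded_of_forall_mem_Icc (A := A) (C := c) fun z hz => hbox z hz.1)
      S (fun z hz => hS z hz) (∑ _k : ι, A - δ / 2)
    have hT₃ : T₃ = ∅ := by
      refine Finset.eq_empty_of_forall_notMem fun z hz => ?_
      have h := (h3 z hz).1
      have hz := hbox z fun i hi => by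
        have := congrFun h i
        rw [Function.update_of_ne hi] at this
        rw [this]
        exact (hv i).le
      have hsum : ∑ _k : ι, A ≤ ∑ k, z k := Finset.sum_le_sum fun k _ => (hz k).1
      have hq := congrFun h q
      rw [Function.update_self] at hq
      have := (abs_lt.mp (hv q)).2
      linarith
    have hrec : ∀ (p : MvPolynomial ι ℝ) (T : Finset (ι → ℝ)), p.totalDegree ≤ ∑ i, d i →
        (∀ z ∈ T, Function.update (logSystem P β z) q (eval (fun k => Real.exp (z k)) p) = v ∧
          (fderiv ℝ (fun z => Function.update (logSystem P β z) q
            (eval (fun k => Real.exp (z k)) p)) z).det ≠ 0) →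
        2 * T.card ≤ (∏ i ∈ (insert q₀ (insert q Q))ᶜ, d i) *
          (2 * ∏ k ∈ Finset.range ((insert q Q).card + 1), (2 ^ k * ∑ i, d i) +
            (∏ k ∈ Finset.range (insert q Q).card, (2 ^ k * ∑ i, d i)) * Fintype.card ι) := by
      intro p T hp h
      rw [← logSystem_update_zero] at h
      have hdq : d q = 0 := hdQ q (by simp)
      have key := ih (fun h => hqQ (Finset.mem_insert_of_mem h))
        (hLQ.mono_right (Finset.subset_insert _ _))
        (P := fun i => Function.update P q p i - C (v i)) (β := Function.update β q 0)
        (d := Function.update d q (∑ i, d i)) (totalDegree_update_sub_C_le hd hp v)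
        (fun i hi => by
          have hiq : i ≠ q := by
            rintro rfl
            rcases Finset.mem_insert.mp hi with h | h
            exacts [hqq₀ h.symm, hq h]
          rw [Function.update_of_ne hiq]
          refine hdQ i ?_
          simp only [Finset.mem_insert] at hi ⊢
          tauto)
        (fun i hi => by
          by_cases hiq : i = q
          · subst hiq
            simp
          · rw [Function.update_of_ne hiq]
            refine hβQ i ?_
            simp only [Finset.mem_insert] at hi ⊢
            tauto)
        (fun k => by simpa [hqq₀] using hβ k) (half_pos hδ)
        (fun z hz => hc z fun i hi => by
          have hiq := ne_of_mem_of_not_mem hi hqL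
          have h1 := hz i hi
          have h2 := (hv i).le
          have h3 : logSystem P β z i =
              logSystem (fun i => Function.update P q p i - C (v i))
                (Function.update β q 0) z i + v i := by
            simp [logSystem, hiq]
            ring
          rw [h3]
          exact (abs_add_le _ _).trans (by linarith)) T
        (fun z hz => isNondegenerateLogZero_sub_C
          ((congrFun (logSystem_update_zero P β q p) z).trans (h z hz).1) (h z hz).2)
      refine key.trans_eq ?_
      have e1 : ∑ i, Function.update d q (∑ i, d i) i = 2 * ∑ i, d i := by
        rw [Finset.sum_update_of_mem (Finset.mem_univ _), Finset.sdiff_singleton_eq_erase,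
          Finset.sum_erase _ hdq, two_mul]
      have e2 : ∏ i ∈ (insert q₀ Q)ᶜ, Function.update d q (∑ i, d i) i =
          (∑ i, d i) * ∏ i ∈ (insert q₀ (insert q Q))ᶜ, d i := by
        rw [Finset.prod_update_of_mem (by simp [hq, hqq₀.symm])]
        congr 2
        ext i
        simp only [Finset.mem_sdiff, Finset.mem_compl, Finset.mem_insert, Finset.mem_singleton]
        tauto
      have e3 : ∀ m s : ℕ, s * ∏ k ∈ Finset.range m, (2 ^ k * (2 * s)) =
          ∏ k ∈ Finset.range (m + 1), (2 ^ k * s) := by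
        intro m s
        rw [Finset.prod_range_succ', pow_zero, one_mul, mul_comm]
        congr 1
        exact Finset.prod_congr rfl fun k _ => by ring
      rw [e1, e2, Finset.card_insert_of_notMem hq, ← e3 (Q.card + 1) (∑ i, d i),
        ← e3 Q.card (∑ i, d i)]
      ring
    have b1 := hrec _ T₁ (totalDegree_logJacobian_le hd) h1
    have b2 := hrec (-logJacobian P β) T₂
      ((totalDegree_neg _).trans_le (totalDegree_logJacobian_le hd))
      (by simpa only [hJneg] using h2)
    rw [hT₃, Finset.card_empty] at hT
    lia

end Khovanskii

section LinearRows

variable {κ μ : Type*} [Fintype κ] [Fintype μ]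

/-- The rows `c₀ i + ∑ k, c i k * X k` for `i : κ`, followed by zero rows. -/
noncomputable def linearRows (μ : Type*) [Fintype μ] (c₀ : κ → ℝ) (c : κ → κ ⊕ μ → ℝ) :
    κ ⊕ μ → MvPolynomial (κ ⊕ μ) ℝ :=
  Sum.elim (fun i => C (c₀ i) + ∑ k, C (c i k) * X k) 0

theorem logSystem_linearRows_inl (c₀ : κ → ℝ) (c : κ → κ ⊕ μ → ℝ) (β : μ → κ ⊕ μ → ℝ)
    (z : κ ⊕ μ → ℝ) (i : κ) :
    logSystem (linearRows μ c₀ c) (Sum.elim 0 β) z (Sum.inl i) =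
      c₀ i + ∑ k, c i k * Real.exp (z k) := by
  simp only [logSystem, linearRows, Sum.elim_inl, map_add, map_sum, map_mul, eval_C, eval_X,
    Pi.zero_apply, zero_mul, Finset.sum_const_zero, add_zero]

theorem logSystem_linearRows_inr (c₀ : κ → ℝ) (c : κ → κ ⊕ μ → ℝ) (β : μ → κ ⊕ μ → ℝ)
    (z : κ ⊕ μ → ℝ) (j : μ) :
    logSystem (linearRows μ c₀ c) (Sum.elim 0 β) z (Sum.inr j) = ∑ k, β j k * z k := by
  simp only [logSystem, linearRows, Sum.elim_inr, Pi.zero_apply, map_zero, zero_add]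

theorem totalDegree_linearRows_le (c₀ : κ → ℝ) (c : κ → κ ⊕ μ → ℝ) (i : κ ⊕ μ) :
    (linearRows μ c₀ c i).totalDegree ≤ Sum.elim (1 : κ → ℕ) (0 : μ → ℕ) i := by
  rcases i with i | i
  · simp only [linearRows, Sum.elim_inl, Pi.one_apply]
    refine (totalDegree_add _ _).trans (max_le (by simp) ?_)
    refine totalDegree_finsetSum_le fun k _ => (totalDegree_mul _ _).trans ?_
    simp
  · simp [linearRows]

theorem exists_forall_le_of_sum_mul_exp_le {ι : Type*} [Fintype ι] {w : ι → ℝ}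
    (hw : ∀ k, 0 < w k) (K : ℝ) :
    ∃ A, ∀ z : ι → ℝ, ∑ k, w k * Real.exp (z k) ≤ K → ∀ k, z k ≤ A := by
  obtain ⟨A, hA⟩ := (Set.finite_range fun k => K / w k).bddAbove
  refine ⟨A, fun z hz k => le_trans ?_ (hA ⟨k, rfl⟩)⟩
  rw [le_div_iff₀ (hw k)]
  have h1 : w k * Real.exp (z k) ≤ ∑ k, w k * Real.exp (z k) :=
    Finset.single_le_sum (f := fun k => w k * Real.exp (z k))
      (fun j _ => mul_nonneg (hw j).le (Real.exp_pos _).le) (Finset.mem_univ k)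
  nlinarith [Real.add_one_le_exp (z k), hw k]

variable [DecidableEq κ] [DecidableEq μ]

theorem eval_logJacobian_linearRows (c₀ : κ → ℝ) (c : κ → κ ⊕ μ → ℝ) (β : μ → κ ⊕ μ → ℝ)
    (z : κ ⊕ μ → ℝ) :
    eval (fun k => Real.exp (z k)) (logJacobian (linearRows μ c₀ c) (Sum.elim 0 β)) =
      (Matrix.of (Sum.elim (fun i k => c i k * Real.exp (z k)) β)).det := by
  rw [logJacobian, RingHom.map_det]
  congr 1
  ext i k
  rcases i with i | i
  · have h : pderiv k (C (c₀ i) + ∑ j, C (c i j) * X j : MvPolynomial (κ ⊕ μ) ℝ) =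
        C (c i k) := by
      rw [map_add, pderiv_C, zero_add, map_sum, Finset.sum_eq_single k]
      · simp
      · intro j _ hj
        rw [pderiv_C_mul, pderiv_X_of_ne hj, mul_zero]
      · simp
    simp only [linearRows, RingHom.mapMatrix_apply, Matrix.map_apply, Matrix.of_apply,
      Sum.elim_inl, h]
    simp [mul_comm]
  · simp [linearRows]

/-- Gale dual form of the fewnomial bound, when a linear combination of the affine equations has
positive coefficients. -/
theorem two_mul_card_le_of_linearRows_of_pos {c₀ : κ → ℝ} {c : κ → κ ⊕ μ → ℝ}
    {β : μ → κ ⊕ μ → ℝ} {j₀ : μ} (hβ : ∀ k, 0 < β j₀ k) {u : κ → ℝ}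
    (hu : ∀ k, 0 < ∑ i, u i * c i k) (S : Finset (κ ⊕ μ → ℝ))
    (hS : ∀ z ∈ S, IsNondegenerateLogZero (linearRows μ c₀ c) (Sum.elim 0 β) z) :
    2 * S.card ≤ 2 * ∏ k ∈ Finset.range (Fintype.card μ), (2 ^ k * Fintype.card κ) +
      (∏ k ∈ Finset.range (Fintype.card μ - 1), (2 ^ k * Fintype.card κ)) *
        (Fintype.card κ + Fintype.card μ) := by
  let Q : Finset (κ ⊕ μ) := (Finset.univ.erase j₀).map Function.Embedding.inr
  have hQ : ∀ i : κ ⊕ μ, i ∈ insert (Sum.inr j₀) Q ↔ ∃ j, i = Sum.inr j := by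
    intro i
    rcases i with i | j
    · simp [Q]
    · by_cases h : j = j₀ <;> simp [Q, h]
  have hQcard : Q.card = Fintype.card μ - 1 := by
    rw [Finset.card_map, Finset.card_erase_of_mem (Finset.mem_univ _), Finset.card_univ]
  have hμ : 0 < Fintype.card μ := Fintype.card_pos_iff.mpr ⟨j₀⟩
  obtain ⟨A, hA⟩ := exists_forall_le_of_sum_mul_exp_le hu (∑ i, |u i| * (1 + |c₀ i|))
  have key := two_mul_card_le_of_isNondegenerateLogZero (q₀ := Sum.inr j₀)
    (L := Finset.univ.map Function.Embedding.inl) (by simp) Q (by simp [Q])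
    (by
      rw [Finset.disjoint_left]
      intro i hi
      obtain ⟨i, -, rfl⟩ := Finset.mem_map.mp hi
      simp [Q])
    (totalDegree_linearRows_le c₀ c) (β := Sum.elim 0 β)
    (fun i hi => by
      obtain ⟨j, rfl⟩ := (hQ i).mp hi
      rfl)
    (fun i hi => by
      rcases i with i | j
      · rfl
      · exact absurd ((hQ _).mpr ⟨j, rfl⟩) hi)
    (fun k => hβ k) one_pos (c := A)
    (fun z hz => hA z (by
      have h1 : ∀ i, |c₀ i + ∑ k, c i k * Real.exp (z k)| ≤ 1 := fun i => by
        rw [← logSystem_linearRows_inl c₀ c β z i]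
        exact hz _ (by simp)
      calc ∑ k, (∑ i, u i * c i k) * Real.exp (z k)
          = ∑ i, u i * ∑ k, c i k * Real.exp (z k) := by
            simp only [Finset.sum_mul, Finset.mul_sum]
            rw [Finset.sum_comm]
            simp only [mul_assoc]
        _ ≤ ∑ i, |u i| * (1 + |c₀ i|) := Finset.sum_le_sum fun i _ => by
            refine (le_abs_self _).trans ?_
            rw [abs_mul]
            refine mul_le_mul_of_nonneg_left ?_ (abs_nonneg _)
            have h2 : ∑ k, c i k * Real.exp (z k) =
              (c₀ i + ∑ k, c i k * Real.exp (z k)) - c₀ i := by ring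
            rw [h2]
            exact (abs_sub _ _).trans (by linarith [h1 i])))
    S hS
  have hprod : ∏ i ∈ (insert (Sum.inr j₀) Q)ᶜ, Sum.elim (1 : κ → ℕ) (0 : μ → ℕ) i = 1 := by
    refine Finset.prod_eq_one fun i hi => ?_
    rcases i with i | j
    · rfl
    · exact absurd ((hQ _).mpr ⟨j, rfl⟩) (Finset.mem_compl.mp hi)
  have hsum : ∑ i, Sum.elim (1 : κ → ℕ) (0 : μ → ℕ) i = Fintype.card κ := by simp
  rwa [hprod, hsum, hQcard, Nat.sub_add_cancel hμ, one_mul, Fintype.card_sum] at key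

/-- Gale dual form of the fewnomial bound, when a nontrivial linear combination of the affine
equations has nonnegative coefficients. -/
theorem two_mul_card_le_of_linearRows {c₀ : κ → ℝ} {c : κ → κ ⊕ μ → ℝ}
    {β : μ → κ ⊕ μ → ℝ} {j₀ : μ} (hβ : ∀ k, 0 < β j₀ k) {u : κ → ℝ} (hu0 : u ≠ 0)
    (hu : ∀ k, 0 ≤ ∑ i, u i * c i k) (S : Finset (κ ⊕ μ → ℝ))
    (hS : ∀ z ∈ S, IsNondegenerateLogZero (linearRows μ c₀ c) (Sum.elim 0 β) z) :
    2 * S.card ≤ 2 * ∏ k ∈ Finset.range (Fintype.card μ), (2 ^ k * Fintype.card κ) +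
      (∏ k ∈ Finset.range (Fintype.card μ - 1), (2 ^ k * Fintype.card κ)) *
        (Fintype.card κ + Fintype.card μ) := by
  let c' : ℝ → κ → κ ⊕ μ → ℝ := fun ε i k => c i k + ε * u i
  let F : ℝ × (κ ⊕ μ → ℝ) → κ ⊕ μ → ℝ := fun x =>
    logSystem (linearRows μ c₀ (c' x.1)) (Sum.elim 0 β) x.2
  let D : ℝ × (κ ⊕ μ → ℝ) → ℝ := fun x => eval (fun k => Real.exp (x.2 k))
    (logJacobian (linearRows μ c₀ (c' x.1)) (Sum.elim 0 β))
  have hF : ContDiff ℝ 1 F := by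
    rw [contDiff_pi]
    rintro (i | j)
    · simp only [F, logSystem_linearRows_inl, c']
      refine contDiff_const.add (ContDiff.sum fun k _ => ?_)
      exact (contDiff_const.add (contDiff_fst.mul contDiff_const)).mul
        (Real.contDiff_exp.comp ((contDiff_apply ℝ ℝ k).comp contDiff_snd))
    · simp only [F, logSystem_linearRows_inr]
      exact ContDiff.sum fun k _ =>
        contDiff_const.mul ((contDiff_apply ℝ ℝ k).comp contDiff_snd)
  have hD : Continuous D := by
    simp only [D, eval_logJacobian_linearRows]
    refine Continuous.matrix_det (continuous_matrix ?_)
    rintro (i | j) k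
    · simp only [Matrix.of_apply, Sum.elim_inl, c']
      fun_prop
    · simp only [Matrix.of_apply, Sum.elim_inr]
      exact continuous_const
  have hc'0 : c' 0 = c := by
    ext i k
    simp [c']
  have hev := eventually_exists_zeros hF S (W := {x | D x ≠ 0})
    (fun z hz => by
      have h : (fun w => F (0, w)) = logSystem (linearRows μ c₀ c) (Sum.elim 0 β) := by
        simp only [F, hc'0]
      refine ⟨(congrFun h z).trans (hS z hz).1, ?_⟩
      rw [h]
      refine ContDiff.surjective_fderiv_of_det_ne_zero ?_
      rw [det_fderiv_logSystem]
      exact (hS z hz).2)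
    (fun z hz => (isOpen_ne_fun hD continuous_const).mem_nhds (by
      simp only [D, hc'0, mem_ofPred_eq]
      exact (hS z hz).2))
  obtain ⟨ε, ⟨S', hS'card, hS'⟩, hε⟩ :=
    ((hev.filter_mono (nhdsWithin_le_nhds (s := Ioi 0))).and self_mem_nhdsWithin).exists
  rw [← hS'card]
  refine two_mul_card_le_of_linearRows_of_pos hβ (c := c' ε) (u := u) (fun k => ?_) S' hS'
  have h1 : ∑ i, u i * c' ε i k = ∑ i, u i * c i k + ε * ∑ i, u i ^ 2 := by
    simp only [c', mul_add, Finset.sum_add_distrib, Finset.mul_sum]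
    congr 1
    exact Finset.sum_congr rfl fun i _ => by ring
  rw [h1]
  obtain ⟨i, hi⟩ := Function.ne_iff.mp hu0
  have h2 : 0 < ∑ i, u i ^ 2 :=
    Finset.sum_pos' (fun i _ => sq_nonneg _) ⟨i, Finset.mem_univ _, sq_pos_of_ne_zero hi⟩
  exact add_pos_of_nonneg_of_pos (hu k) (mul_pos hε h2)

end LinearRows

section LinearAlgebra

variable {ι : Type*} [Fintype ι]

/-- A form of Stiemke's lemma. -/
theorem exists_ne_zero_sum_mul_nonneg {κ : Type*} [Fintype κ] {c : κ → ι → ℝ}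
    (h : ¬ ∃ v : ι → ℝ, (∀ k, 0 < v k) ∧ ∀ i, ∑ k, c i k * v k = 0) :
    ∃ u : κ → ℝ, u ≠ 0 ∧ ∀ k, 0 ≤ ∑ i, u i * c i k := by
  classical
  let l : κ → (ι → ℝ) →ₗ[ℝ] ℝ := fun i => ∑ k, c i k • LinearMap.proj k
  have hl : ∀ i v, l i v = ∑ k, c i k * v k := fun i v => by simp [l]
  let s : Set (ι → ℝ) := Set.pi univ fun _ => Ioi 0
  have hs : IsOpen s := isOpen_set_pi finite_univ fun _ _ => isOpen_Ioi
  have hsc : Convex ℝ s := convex_pi fun _ _ => convex_Ioi 0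
  let N : Submodule ℝ (ι → ℝ) := ⨅ i, LinearMap.ker (l i)
  have hdisj : Disjoint s (N : Set (ι → ℝ)) := by
    rw [Set.disjoint_left]
    intro v hv hvN
    refine h ⟨v, fun k => hv k (mem_univ k), fun i => ?_⟩
    rw [← hl]
    exact (Submodule.mem_iInf _).mp hvN i
  obtain ⟨f, r, hf1, hf2⟩ := geometric_hahn_banach_open hsc hs N.convex hdisj
  have hr : r ≤ 0 := by simpa using hf2 0 N.zero_mem
  have hfN : N ≤ LinearMap.ker (f : (ι → ℝ) →ₗ[ℝ] ℝ) := by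
    intro v hv
    rw [LinearMap.mem_ker]
    change f v = 0
    by_contra hne
    have := hf2 (((r - 1) / f v) • v) (N.smul_mem _ hv)
    rw [map_smul, smul_eq_mul, div_mul_cancel₀ _ hne] at this
    linarith
  have hspan := mem_span_of_iInf_ker_le_ker hfN
  obtain ⟨u, hu⟩ := (Submodule.mem_span_range_iff_exists_fun ℝ).mp hspan
  have hfu : ∀ v, f v = ∑ i, u i * ∑ k, c i k * v k := fun v => by
    have := LinearMap.congr_fun hu v
    simp only [LinearMap.sum_apply, LinearMap.smul_apply, smul_eq_mul, hl] at this
    exact this.symm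
  have hone : f (fun _ => 1) < 0 := (hf1 _ fun k _ => mem_Ioi.mpr one_pos).trans_le hr
  refine ⟨-u, ?_, fun k => ?_⟩
  · rw [Ne, neg_eq_zero]
    rintro rfl
    simp [hfu] at hone
  · have hk : f (Pi.single k 1) ≤ 0 := by
      have hlim : Tendsto (fun ε : ℝ => f (Pi.single k 1 + ε • fun _ => 1)) (𝓝[>] 0)
          (𝓝 (f (Pi.single k 1 + (0 : ℝ) • fun _ => 1))) :=
        (Continuous.tendsto (by fun_prop) 0).mono_left nhdsWithin_le_nhds
      rw [zero_smul, add_zero] at hlim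
      refine le_of_tendsto hlim ?_
      filter_upwards [self_mem_nhdsWithin] with ε hε
      refine (hf1 _ fun j _ => ?_).le.trans hr
      have hε : 0 < ε := hε
      by_cases hjk : j = k
      · subst hjk
        simp only [Pi.add_apply, Pi.single_eq_same, Pi.smul_apply, smul_eq_mul, mem_Ioi]
        linarith
      · simp [hjk, hε]
    rw [hfu] at hk
    simpa [Pi.single_apply] using hk

/-- A point in the relative interior of the convex hull of a finite family is a combination of
the family with positive coefficients. -/
theorem exists_pos_sum_smul_sub_eq_zero {E : Type*} [NormedAddCommGroup E] [NormedSpace ℝ E]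
    [Nonempty ι] {b : ι → E} {x : E}
    (hx : x ∈ intrinsicInterior ℝ (convexHull ℝ (Set.range b))) :
    ∃ w : ι → ℝ, (∀ k, 0 < w k) ∧ ∑ k, w k • (b k - x) = 0 := by
  obtain ⟨y, hy, rfl⟩ := mem_intrinsicInterior.mp hx
  have hN : (0 : ℝ) < Fintype.card ι := Nat.cast_pos.mpr Fintype.card_pos
  let p : E := ∑ k, (Fintype.card ι : ℝ)⁻¹ • b k
  have hp : p ∈ convexHull ℝ (Set.range b) :=
    (convex_convexHull ℝ _).sum_mem (fun _ _ => by positivity) (by simp)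
      fun k _ => subset_convexHull ℝ _ ⟨k, rfl⟩
  let g : ℝ → affineSpan ℝ (convexHull ℝ (Set.range b)) := fun t =>
    ⟨AffineMap.lineMap p (y : E) t,
      AffineMap.lineMap_mem t (subset_affineSpan ℝ _ hp) y.2⟩
  have hg : Continuous g := Continuous.subtype_mk AffineMap.lineMap_continuous _
  have hg1 : g 1 = y := Subtype.ext (by simp [g])
  have hev : ∀ᶠ t in 𝓝 (1 : ℝ), (g t : E) ∈ convexHull ℝ (Set.range b) := by
    have := hg.tendsto 1
    rw [hg1] at this
    exact this (mem_interior_iff_mem_nhds.mp hy)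
  obtain ⟨t, ht, ht1⟩ :=
    ((hev.filter_mono (nhdsWithin_le_nhds (s := Ioi 1))).and self_mem_nhdsWithin).exists
  obtain ⟨s, w, hw0, hw1, hw⟩ :=
    (Set.ext_iff.mp (convexHull_range_eq_exists_affineCombination b) _).mp ht
  rw [Finset.affineCombination_eq_linear_combination _ _ _ hw1] at hw
  have ht1 : 1 < t := ht1
  classical
  let w' : ι → ℝ := fun k => if k ∈ s then w k else 0
  have hw'0 : ∀ k, 0 ≤ w' k := fun k => by
    by_cases hk : k ∈ s
    · simpa [w', hk] using hw0 k hk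
    · simp [w', hk]
  have hw'1 : ∑ k, w' k = 1 := by simpa [w'] using hw1
  have hw' : ∑ k, w' k • b k = p + t • ((y : E) - p) := by
    have h : ∑ k, w' k • b k = ∑ k ∈ s, w k • b k := by simp [w', ite_smul]
    rw [h, hw]
    simp [g, AffineMap.lineMap_apply_module']
    abel
  refine ⟨fun k => w' k + (t - 1) * (Fintype.card ι : ℝ)⁻¹, fun k => ?_, ?_⟩
  · exact add_pos_of_nonneg_of_pos (hw'0 k) (mul_pos (by linarith) (inv_pos.mpr hN))
  · have hpp : ∑ k, ((t - 1) * (Fintype.card ι : ℝ)⁻¹) • b k = (t - 1) • p := by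
      simp only [p, Finset.smul_sum, smul_smul]
    have hone : ∑ _k : ι, (t - 1) * (Fintype.card ι : ℝ)⁻¹ = t - 1 := by
      rw [Finset.sum_const, Finset.card_univ, nsmul_eq_mul]
      field_simp
    simp only [smul_sub, add_smul, Finset.sum_sub_distrib, Finset.sum_add_distrib, hw', hpp]
    rw [← Finset.sum_smul, ← Finset.sum_smul, hw'1, hone]
    module

theorem exists_basis_fin_apply_eq {K V : Type*} [Field K] [AddCommGroup V] [Module K V]
    [FiniteDimensional K V] {ℓ : ℕ} (hℓ : Module.finrank K V = ℓ) {x : V} (hx : x ≠ 0) :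
    ∃ b : Module.Basis (Fin ℓ) K V, ∃ j, b j = x := by
  classical
  have hs : LinearIndepOn K id ({x} : Set V) := (linearIndepOn_singleton_iff K).mpr hx
  let b := Module.Basis.extend hs
  have : Fintype (hs.extend (subset_univ _)) := FiniteDimensional.fintypeBasisIndex b
  have e : hs.extend (subset_univ _) ≃ Fin ℓ :=
    Fintype.equivFinOfCardEq (by rw [← Module.finrank_eq_card_basis b, hℓ])
  refine ⟨b.reindex e, e ⟨x, hs.subset_extend _ (mem_singleton _)⟩, ?_⟩
  simp [b]

/-- The orthogonal complement of a subspace has a basis starting at a prescribed nonzero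
vector. -/
theorem exists_forall_sum_mul_eq_zero_iff_mem (W : Submodule ℝ (ι → ℝ)) {ℓ : ℕ}
    (hℓ : Module.finrank ℝ W + ℓ = Fintype.card ι) {w : ι → ℝ} (hw : w ≠ 0)
    (hwW : ∀ v ∈ W, ∑ k, w k * v k = 0) :
    ∃ β : Fin ℓ → ι → ℝ, (∃ j, β j = w) ∧ ∀ v, (∀ j, ∑ k, β j k * v k = 0) ↔ v ∈ W := by
  classical
  let N : Submodule ℝ (Module.Dual ℝ (ι → ℝ)) := W.dualAnnihilator
  have hN : Module.finrank ℝ N = ℓ := by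
    have := Subspace.finrank_add_finrank_dualAnnihilator_eq W
    rw [Module.finrank_fintype_fun_eq_card, ← hℓ] at this
    exact Nat.add_left_cancel this
  let f : Module.Dual ℝ (ι → ℝ) := ∑ k, w k • LinearMap.proj k
  have hf : ∀ v, f v = ∑ k, w k * v k := fun v => by simp [f]
  have hfN : f ∈ N := (Submodule.mem_dualAnnihilator f).mpr fun v hv => (hf v).trans (hwW v hv)
  have hf0 : (⟨f, hfN⟩ : N) ≠ 0 := by
    intro h
    have h0 : f = 0 := congrArg Subtype.val h
    refine hw (funext fun k => ?_)
    have := hf (Pi.single k 1)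
    simpa [h0, Pi.single_apply] using this.symm
  obtain ⟨b', j₀, hj₀⟩ := exists_basis_fin_apply_eq (V := N) hN hf0
  have hb' : ∀ j v, ((b' j : N) : Module.Dual ℝ (ι → ℝ)) v =
      ∑ k, ((b' j : N) : Module.Dual ℝ (ι → ℝ)) (Pi.single k 1) * v k := fun j v => by
    conv_lhs => rw [pi_eq_sum_univ v, map_sum]
    refine Finset.sum_congr rfl fun k _ => ?_
    rw [map_smul, smul_eq_mul, mul_comm]
    congr 2
    ext j
    simp [Pi.single_apply, eq_comm]
  refine ⟨fun j k => ((b' j : N) : Module.Dual ℝ (ι → ℝ)) (Pi.single k 1), ?_, fun v => ?_⟩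
  · refine ⟨j₀, funext fun k => ?_⟩
    simp only [hj₀, hf]
    simp [Pi.single_apply]
  · simp only [← hb']
    constructor
    · intro h
      rw [← Subspace.dualAnnihilator_dualCoannihilator_eq (W := W),
        Submodule.mem_dualCoannihilator]
      intro φ hφ
      have h2 : (⟨φ, hφ⟩ : N) ∈ LinearMap.ker ((LinearMap.applyₗ v).comp N.subtype) := by
        have : (LinearMap.applyₗ v).comp N.subtype = 0 := b'.ext fun j => h j
        rw [this]
        simp
      simpa using h2
    · intro hv j
      exact (Submodule.mem_dualAnnihilator _).mp (b' j).2 v hv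

end LinearAlgebra

section Laurent

variable {n : ℕ} {ι : Type*}

/-- The logarithms of the ratios of the monomials with exponents `a k` and `a0`, as linear
functions of the logarithms of the variables. -/
noncomputable def logMonomialRatio (a0 : Fin n → ℤ) (a : ι → Fin n → ℤ) :
    (Fin n → ℝ) →ₗ[ℝ] (ι → ℝ) :=
  LinearMap.pi fun k => ∑ j, ((a k j : ℝ) - a0 j) • LinearMap.proj j

theorem logMonomialRatio_apply (a0 : Fin n → ℤ) (a : ι → Fin n → ℤ) (y : Fin n → ℝ) (k : ι) :
    logMonomialRatio a0 a y k = ∑ j, ((a k j : ℝ) - a0 j) * y j := by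
  simp [logMonomialRatio]

theorem prod_exp_zpow (y : Fin n → ℝ) (b : Fin n → ℤ) :
    ∏ j, Real.exp (y j) ^ b j = Real.exp (∑ j, (b j : ℝ) * y j) := by
  rw [Real.exp_sum]
  exact Finset.prod_congr rfl fun j _ => by
    rw [mul_comm, Real.exp_mul, Real.rpow_intCast]

theorem prod_exp_zpow_eq_mul_exp_logMonomialRatio (a0 : Fin n → ℤ) (a : ι → Fin n → ℤ)
    (y : Fin n → ℝ) (k : ι) :
    ∏ j, Real.exp (y j) ^ a k j =
      (∏ j, Real.exp (y j) ^ a0 j) * Real.exp (logMonomialRatio a0 a y k) := by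
  rw [prod_exp_zpow, prod_exp_zpow, ← Real.exp_add, logMonomialRatio_apply,
    ← Finset.sum_add_distrib]
  congr 1
  exact Finset.sum_congr rfl fun j _ => by ring

variable [Fintype ι] {a0 : Fin n → ℤ} {a : ι → Fin n → ℤ} {c0 : Fin n → ℝ} {c : Fin n → ι → ℝ}
  {Φ : (Fin n → ℝ) → Fin n → ℝ}

theorem laurent_exp_eq
    (hΦ : ∀ x i, Φ x i = c0 i * ∏ j, x j ^ a0 j + ∑ k, c i k * ∏ j, x j ^ a k j)
    (y : Fin n → ℝ) (i : Fin n) :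
    Φ (fun j => Real.exp (y j)) i = (∏ j, Real.exp (y j) ^ a0 j) *
      (c0 i + ∑ k, c i k * Real.exp (logMonomialRatio a0 a y k)) := by
  simp only [hΦ, prod_exp_zpow_eq_mul_exp_logMonomialRatio a0 a y, mul_add, Finset.mul_sum]
  congr 1
  · ring
  · exact Finset.sum_congr rfl fun k _ => by ring

theorem prod_exp_zpow_pos (y : Fin n → ℝ) (b : Fin n → ℤ) : 0 < ∏ j, Real.exp (y j) ^ b j :=
  Finset.prod_pos fun _ _ => zpow_pos (Real.exp_pos _) _

theorem add_sum_mul_exp_eq_zero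
    (hΦ : ∀ x i, Φ x i = c0 i * ∏ j, x j ^ a0 j + ∑ k, c i k * ∏ j, x j ^ a k j)
    {y : Fin n → ℝ} {i : Fin n} (h : Φ (fun j => Real.exp (y j)) i = 0) :
    c0 i + ∑ k, c i k * Real.exp (logMonomialRatio a0 a y k) = 0 := by
  rw [laurent_exp_eq hΦ] at h
  exact (mul_eq_zero.mp h).resolve_left (prod_exp_zpow_pos y a0).ne'

/-- At a nondegenerate zero, the derivative of the system divided by the monomial with exponent
`a0`, in logarithmic coordinates, is injective. -/
theorem eq_zero_of_forall_sum_mul_logMonomialRatio_eq_zero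
    (hΦ : ∀ x i, Φ x i = c0 i * ∏ j, x j ^ a0 j + ∑ k, c i k * ∏ j, x j ^ a k j)
    {y : Fin n → ℝ} (h0 : ∀ i, Φ (fun j => Real.exp (y j)) i = 0)
    {D : (Fin n → ℝ) ≃L[ℝ] (Fin n → ℝ)}
    (hD : HasFDerivAt Φ (D : (Fin n → ℝ) →L[ℝ] (Fin n → ℝ)) fun j => Real.exp (y j))
    {w : Fin n → ℝ}
    (hw : ∀ i, ∑ k, c i k * Real.exp (logMonomialRatio a0 a y k) *
      logMonomialRatio a0 a w k = 0) : w = 0 := by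
  have hline : ∀ j, HasDerivAt (fun s : ℝ => y j + s * w j) (w j) 0 := fun j => by
    simpa using ((hasDerivAt_id (0 : ℝ)).mul_const (w j)).const_add (y j)
  have hcurve : HasDerivAt (fun (s : ℝ) j => Real.exp (y j + s * w j))
      (fun j => Real.exp (y j) * w j) 0 := by
    rw [hasDerivAt_pi]
    intro j
    simpa using (hline j).exp
  have h1 : HasDerivAt (fun s : ℝ => Φ fun j => Real.exp (y j + s * w j))
      (D fun j => Real.exp (y j) * w j) 0 := by
    have hD' : HasFDerivAt Φ (D : (Fin n → ℝ) →L[ℝ] (Fin n → ℝ))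
        ((fun (s : ℝ) j => Real.exp (y j + s * w j)) 0) := by simpa using hD
    exact hD'.comp_hasDerivAt 0 hcurve
  have h2 : ∀ i, (D fun j => Real.exp (y j) * w j) i = 0 := by
    intro i
    have hmon : HasDerivAt (fun s : ℝ => ∏ j, Real.exp (y j + s * w j) ^ a0 j)
        (Real.exp (∑ j, (a0 j : ℝ) * y j) * ∑ j, (a0 j : ℝ) * w j) 0 := by
      simp only [fun s : ℝ => prod_exp_zpow (fun j => y j + s * w j) a0]
      simpa using (HasDerivAt.fun_sum (u := Finset.univ) fun j _ =>
        (hline j).const_mul (a0 j : ℝ)).exp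
    have hratio : ∀ k, HasDerivAt
        (fun s : ℝ => logMonomialRatio a0 a (fun j => y j + s * w j) k)
        (logMonomialRatio a0 a w k) 0 := fun k => by
      simp only [logMonomialRatio_apply]
      exact HasDerivAt.fun_sum fun j _ => (hline j).const_mul _
    have hsum := (HasDerivAt.fun_sum (u := Finset.univ) fun k _ =>
      (hratio k).exp.const_mul (c i k)).const_add (c0 i)
    have h3 := hmon.mul hsum
    have h4 := (hasDerivAt_pi.mp h1) i
    simp only [laurent_exp_eq hΦ] at h4
    rw [h4.unique h3]
    simp only [zero_mul, add_zero, add_sum_mul_exp_eq_zero hΦ (h0 i), mul_zero, zero_add]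
    simp only [← mul_assoc, hw i, mul_zero]
  have h5 : (fun j => Real.exp (y j) * w j) = 0 := D.injective (by
    rw [map_zero]
    exact funext h2)
  ext j
  exact (mul_eq_zero.mp (congrFun h5 j)).resolve_left (Real.exp_pos _).ne'

/-- The bound for any finite set of nondegenerate positive solutions. -/
theorem two_mul_card_le_of_laurent {ℓ : ℕ} {a : Fin n ⊕ Fin ℓ → Fin n → ℤ}
    {c : Fin n → Fin n ⊕ Fin ℓ → ℝ} (hn : 1 ≤ n)
    (hΦ : ∀ x i, Φ x i = c0 i * ∏ j, x j ^ a0 j + ∑ k, c i k * ∏ j, x j ^ a k j)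
    (hconv : (fun j => (a0 j : ℝ)) ∈
      intrinsicInterior ℝ (convexHull ℝ (Set.range fun k => fun j => ((a k j : ℝ)))))
    (hker : ¬ ∃ v : Fin n ⊕ Fin ℓ → ℝ, (∀ k, 0 < v k) ∧ ∀ i, ∑ k, c i k * v k = 0)
    (S : Finset (Fin n → ℝ))
    (hS : ∀ x ∈ S, (∀ j, 0 < x j) ∧ (∀ i, Φ x i = 0) ∧
        ∃ D : (Fin n → ℝ) ≃L[ℝ] (Fin n → ℝ),
          HasFDerivAt Φ (D : (Fin n → ℝ) →L[ℝ] (Fin n → ℝ)) x) :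
    2 * S.card ≤ 2 * ∏ k ∈ Finset.range ℓ, (2 ^ k * n) +
      (∏ k ∈ Finset.range (ℓ - 1), (2 ^ k * n)) * (n + ℓ) := by
  classical
  let A := logMonomialRatio a0 a
  have hexp : ∀ x ∈ S, (fun j => Real.exp (Real.log (x j))) = x := fun x hx =>
    funext fun j => Real.exp_log ((hS x hx).1 j)
  have hzero : ∀ x ∈ S, ∀ i,
      c0 i + ∑ k, c i k * Real.exp (A (fun j => Real.log (x j)) k) = 0 := fun x hx i => by
    refine add_sum_mul_exp_eq_zero hΦ ?_
    rw [hexp x hx]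
    exact (hS x hx).2.1 i
  have hinj : ∀ x ∈ S, ∀ w, (∀ i, ∑ k, c i k * Real.exp (A (fun j => Real.log (x j)) k) *
      A w k = 0) → w = 0 := fun x hx w hw => by
    obtain ⟨D, hD⟩ := (hS x hx).2.2
    rw [← hexp x hx] at hD
    refine eq_zero_of_forall_sum_mul_logMonomialRatio_eq_zero hΦ (fun i => ?_) hD hw
    rw [hexp x hx]
    exact (hS x hx).2.1 i
  obtain rfl | ⟨x₀, hx₀⟩ := S.eq_empty_or_nonempty
  · simp
  have hA : Function.Injective A := by
    rw [← LinearMap.ker_eq_bot, LinearMap.ker_eq_bot']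
    exact fun w hw => hinj x₀ hx₀ w fun i => by simp [hw]
  have : Nonempty (Fin n ⊕ Fin ℓ) := ⟨Sum.inl ⟨0, hn⟩⟩
  obtain ⟨b, hb0, hb⟩ := exists_pos_sum_smul_sub_eq_zero hconv
  have hbA : ∀ v ∈ LinearMap.range A, ∑ k, b k * v k = 0 := by
    rintro _ ⟨y, rfl⟩
    simp only [A, logMonomialRatio_apply, Finset.mul_sum]
    rw [Finset.sum_comm]
    refine Finset.sum_eq_zero fun j _ => ?_
    have := congrFun hb j
    simp only [Finset.sum_apply, Pi.smul_apply, Pi.sub_apply, smul_eq_mul, Pi.zero_apply] at this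
    simp only [← mul_assoc, ← Finset.sum_mul, this, zero_mul]
  have hrank : Module.finrank ℝ (LinearMap.range A) + ℓ = Fintype.card (Fin n ⊕ Fin ℓ) := by
    rw [LinearMap.finrank_range_of_inj hA]
    simp
  have hb_ne : b ≠ 0 := fun h => (hb0 (Sum.inl ⟨0, hn⟩)).ne' (congrFun h _)
  obtain ⟨β, ⟨j₀, hj₀⟩, hβ⟩ := exists_forall_sum_mul_eq_zero_iff_mem _ hrank hb_ne hbA
  obtain ⟨u, hu0, hu⟩ := exists_ne_zero_sum_mul_nonneg hker
  have hcard : (S.image fun x => A fun j => Real.log (x j)).card = S.card := by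
    refine Finset.card_image_of_injOn fun x hx y hy hxy => ?_
    rw [← hexp x hx, ← hexp y hy]
    ext j
    exact congrArg Real.exp (congrFun (hA hxy) j)
  rw [← hcard]
  have key := two_mul_card_le_of_linearRows (c₀ := c0) (c := c) (β := β) (j₀ := j₀)
    (fun k => by rw [hj₀]; exact hb0 k) hu0 hu (S.image fun x => A fun j => Real.log (x j))
    (fun z hz => by
      obtain ⟨x, hx, rfl⟩ := Finset.mem_image.mp hz
      refine ⟨?_, ?_⟩
      · ext i
        rcases i with i | j
        · rw [logSystem_linearRows_inl]
          exact hzero x hx i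
        · rw [logSystem_linearRows_inr]
          exact (hβ _).mpr ⟨_, rfl⟩ j
      · rw [eval_logJacobian_linearRows]
        intro hdet
        obtain ⟨v, hv0, hv⟩ := Matrix.exists_mulVec_eq_zero_iff.mpr hdet
        obtain ⟨w, rfl⟩ := (hβ v).mp fun j => congrFun hv (Sum.inr j)
        refine hv0 ?_
        rw [hinj x hx w fun i => congrFun hv (Sum.inl i), map_zero])
  simpa only [Fintype.card_fin] using key

end Laurent

theorem prod_range_two_pow_mul (m s : ℕ) :
    ∏ k ∈ Finset.range m, (2 ^ k * s) = 2 ^ (m * (m - 1) / 2) * s ^ m := by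
  rw [Finset.prod_mul_distrib, Finset.prod_pow_eq_pow_sum, Finset.sum_range_id,
    Finset.prod_const, Finset.card_range]

theorem two_mul_prod_add_eq {n ℓ : ℕ} (hn : 1 ≤ n) (hℓ : 1 ≤ ℓ) :
    ((2 * ∏ k ∈ Finset.range ℓ, (2 ^ k * n) +
      (∏ k ∈ Finset.range (ℓ - 1), (2 ^ k * n)) * (n + ℓ) : ℕ) : ℝ) =
      2 * ((1 + (2 : ℝ) ^ (-(ℓ : ℤ)) * (1 + (ℓ : ℝ) / (n : ℝ))) *
        2 ^ (ℓ * (ℓ - 1) / 2) * (n : ℝ) ^ ℓ) := by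
  obtain ⟨m, rfl⟩ := Nat.exists_eq_succ_of_ne_zero (Nat.one_le_iff_ne_zero.mp hℓ)
  have h1 : ∏ k ∈ Finset.range (m + 1), (2 ^ k * n) =
      (∏ k ∈ Finset.range m, (2 ^ k * n)) * (2 ^ m * n) := Finset.prod_range_succ _ _
  have h2 := congrArg (Nat.cast : ℕ → ℝ) (prod_range_two_pow_mul (m + 1) n)
  push_cast at h2
  have hn0 : (n : ℝ) ≠ 0 := by positivity
  simp only [Nat.succ_eq_add_one, Nat.add_sub_cancel] at h2 ⊢
  rw [mul_assoc _ ((2 : ℝ) ^ _), ← h2]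
  have h3 := congrArg (Nat.cast : ℕ → ℝ) h1
  rw [zpow_neg, zpow_natCast, pow_succ]
  push_cast at h3 ⊢
  rw [h3]
  generalize ∏ k ∈ Finset.range m, ((2 : ℝ) ^ k * n) = p
  field_simp

end

/-- A Descartes'-like bound for fewnomial systems whose exponent vectors are
not in convex position (one exponent vector `a0` in the relative interior of the convex hull
of the others) and whose coefficient matrix for the other monomials has no positive vector
in its kernel. -/
theorem descartes_like_fewnomial_bound
    (n ℓ : ℕ) (hn : 1 ≤ n) (hℓ : 1 ≤ ℓ)
    (a0 : Fin n → ℤ) (a : Fin (n + ℓ) → Fin n → ℤ)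
    (hainj : Function.Injective a) (hane : ∀ k, a k ≠ a0)
    (c0 : Fin n → ℝ) (c : Fin n → Fin (n + ℓ) → ℝ)
    (Φ : (Fin n → ℝ) → Fin n → ℝ)
    (hΦ : ∀ x i, Φ x i =
      c0 i * ∏ j, x j ^ a0 j + ∑ k, c i k * ∏ j, x j ^ a k j)
    (hconv : (fun j => (a0 j : ℝ)) ∈
      intrinsicInterior ℝ (convexHull ℝ (Set.range fun k => fun j => ((a k j : ℝ)))))
    (hker : ¬ ∃ v : Fin (n + ℓ) → ℝ, (∀ k, 0 < v k) ∧ ∀ i, ∑ k, c i k * v k = 0) :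
    {x : Fin n → ℝ | (∀ j, 0 < x j) ∧ (∀ i, Φ x i = 0) ∧
        ∃ D : (Fin n → ℝ) ≃L[ℝ] (Fin n → ℝ),
          HasFDerivAt Φ (D : (Fin n → ℝ) →L[ℝ] (Fin n → ℝ)) x}.Finite ∧
    ({x : Fin n → ℝ | (∀ j, 0 < x j) ∧ (∀ i, Φ x i = 0) ∧
        ∃ D : (Fin n → ℝ) ≃L[ℝ] (Fin n → ℝ),
          HasFDerivAt Φ (D : (Fin n → ℝ) →L[ℝ] (Fin n → ℝ)) x}.ncard : ℝ) ≤
      (1 + (2 : ℝ) ^ (-(ℓ : ℤ)) * (1 + (ℓ : ℝ) / (n : ℝ))) *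
        2 ^ (ℓ * (ℓ - 1) / 2) * (n : ℝ) ^ ℓ := by
  set s := {x : Fin n → ℝ | (∀ j, 0 < x j) ∧ (∀ i, Φ x i = 0) ∧
    ∃ D : (Fin n → ℝ) ≃L[ℝ] (Fin n → ℝ),
      HasFDerivAt Φ (D : (Fin n → ℝ) →L[ℝ] (Fin n → ℝ)) x} with hs
  let e : Fin n ⊕ Fin ℓ ≃ Fin (n + ℓ) := finSumFinEquiv
  have hbound : ∀ S : Finset (Fin n → ℝ), ↑S ⊆ s →
      2 * S.card ≤ 2 * ∏ k ∈ Finset.range ℓ, (2 ^ k * n) +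
        (∏ k ∈ Finset.range (ℓ - 1), (2 ^ k * n)) * (n + ℓ) := by
    intro S hS
    refine two_mul_card_le_of_laurent (a0 := a0) (a := fun k => a (e k)) (c0 := c0)
      (c := fun i k => c i (e k)) hn (fun x i => ?_) ?_ ?_ S fun x hx => hS hx
    · rw [hΦ, ← Equiv.sum_comp e]
    · convert hconv using 3
      exact e.surjective.range_comp fun k => fun j => ((a k j : ℝ))
    · rintro ⟨v, hv0, hv⟩
      refine hker ⟨fun k => v (e.symm k), fun k => hv0 _, fun i => ?_⟩
      rw [← hv i, ← Equiv.sum_comp e]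
      simp
  have hfin : s.Finite := by
    by_contra hinf
    obtain ⟨T, hTs, hT⟩ := Set.Infinite.exists_subset_card_eq hinf
      (2 * ∏ k ∈ Finset.range ℓ, (2 ^ k * n) +
        (∏ k ∈ Finset.range (ℓ - 1), (2 ^ k * n)) * (n + ℓ) + 1)
    have := hbound T hTs
    lia
  refine ⟨hfin, ?_⟩
  have h := hbound hfin.toFinset (by simp)
  rw [← Set.ncard_eq_toFinset_card s hfin] at h
  have h' : ((2 * s.ncard : ℕ) : ℝ) ≤ _ := Nat.cast_le.mpr h
  rw [two_mul_prod_add_eq hn hℓ] at h'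
  push_cast at h'
  linarith
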